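/- arXiv:1809.00956 — 2 statements merged into one kernel-verified Lean document; each statement's English description precedes it below -/
import Mathlib

section
/- Let Z ⊂ ℝ^d be a d-dimensional zonotope with lattice of flats L(Z), and let α be any cone angle on ℝ^d. Then for all i = 0, 1, …, d−1: α̌_i(Z) = W_i(L(Z)) and α̂_i(Z) = (−1)^{d−i} w_{d−i}(L(Z)^op). In particular, the interior and exterior angle vectors of a zonotope are independent of the chosen cone angle and depend only on the lattice of flats of Z. -/
open scoped BigOperators InnerProductSpace Pointwise

noncomputable section

/-- Euclidean space `ℝ^d`. -/
abbrev Euc (d : ℕ) : Type := EuclideanSpace ℝ (Fin d)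

namespace GramAngles

variable {d : ℕ}

/-- The conical (positive) hull of a set. -/
def posHull (S : Set (Euc d)) : Set (Euc d) :=
  {u | ∃ c : ℝ, ∃ p ∈ S, 0 ≤ c ∧ u = c • p}

/-- The dimension of a set: the rank of the linear subspace parallel to its affine hull. -/
def sdim (S : Set (Euc d)) : ℕ := Module.finrank ℝ (vectorSpan ℝ S)

/-- A polyhedral cone with apex at the origin: a finitely generated convex cone. -/
def IsPolyhedralCone (C : Set (Euc d)) : Prop :=
  ∃ (n : ℕ) (v : Fin n → Euc d),
    C = {x | ∃ c : Fin n → ℝ, (∀ i, 0 ≤ c i) ∧ x = ∑ i, c i • v i}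

/-- A cone angle on `ℝ^d`: a simple, normalized valuation on polyhedral cones. -/
structure ConeAngle (d : ℕ) where
  toFun : Set (Euc d) → ℝ
  zero' : toFun {0} = 0
  union' : ∀ C C' : Set (Euc d), IsPolyhedralCone C → IsPolyhedralCone C' →
    IsPolyhedralCone (C ∪ C') → IsPolyhedralCone (C ∩ C') →
    toFun (C ∪ C') = toFun C + toFun C' - toFun (C ∩ C')
  simple' : ∀ C : Set (Euc d), IsPolyhedralCone C → sdim C < d → toFun C = 0
  norm' : toFun Set.univ = 1

/-- A (convex) polytope: the convex hull of a nonempty finite point set. -/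
def IsPolytope (P : Set (Euc d)) : Prop :=
  ∃ s : Finset (Euc d), s.Nonempty ∧ P = convexHull ℝ (s : Set (Euc d))

/-- Faces of a polytope are its exposed subsets (including `∅` and `P` itself). -/
def IsFace (P F : Set (Euc d)) : Prop := IsExposed ℝ P F

open Classical in
/-- A chosen point in the relative interior of `F`. -/
def relPt (F : Set (Euc d)) : Euc d :=
  if h : (intrinsicInterior ℝ F).Nonempty then h.some else 0

/-- The tangent (inner) cone `T_F G = cone(-q + G) + L(G)^⊥`, `q ∈ relint F`. -/
def innerCone (F G : Set (Euc d)) : Set (Euc d) :=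
  posHull ((fun x => x - relPt F) '' G) + (((vectorSpan ℝ G)ᗮ : Submodule ℝ (Euc d)) : Set (Euc d))

/-- The normal cone `N_F G` of `G` at a face `F`. -/
def normalCone (F G : Set (Euc d)) : Set (Euc d) :=
  {c | ∀ x ∈ F, ∀ y ∈ G, ⟪c, y⟫_ℝ ≤ ⟪c, x⟫_ℝ}

/-- The outer cone `O_F G = N_F G + L(F)`. -/
def outerCone (F G : Set (Euc d)) : Set (Euc d) :=
  normalCone F G + ((vectorSpan ℝ F : Submodule ℝ (Euc d)) : Set (Euc d))

/-- Interior angle of `G` at its face `F`, measured by the cone angle `α`. -/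
def intAngle (α : ConeAngle d) (F G : Set (Euc d)) : ℝ := α.toFun (innerCone F G)

/-- Exterior angle of `G` at its face `F`, measured by the cone angle `α`. -/
def extAngle (α : ConeAngle d) (F G : Set (Euc d)) : ℝ := α.toFun (outerCone F G)

/-- `α̂_i(P)`: sum of interior angles over all `i`-dimensional (nonempty) faces of `P`. -/
def intAngleSum (α : ConeAngle d) (P : Set (Euc d)) (i : ℕ) : ℝ :=
  ∑ᶠ F ∈ {F : Set (Euc d) | IsFace P F ∧ F.Nonempty ∧ sdim F = i}, intAngle α F P

/-- `α̌_i(P)`: sum of exterior angles over all `i`-dimensional (nonempty) faces of `P`. -/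
def extAngleSum (α : ConeAngle d) (P : Set (Euc d)) (i : ℕ) : ℝ :=
  ∑ᶠ F ∈ {F : Set (Euc d) | IsFace P F ∧ F.Nonempty ∧ sdim F = i}, extAngle α F P

/-- A zonotope: a translate of a Minkowski sum of finitely many segments. -/
def IsZonotope (Z : Set (Euc d)) : Prop :=
  ∃ (t : Euc d) (n : ℕ) (z : Fin n → Euc d),
    Z = {x | ∃ l : Fin n → ℝ, (∀ i, |l i| ≤ 1) ∧ x = t + ∑ i, l i • z i}

/-- The face of `P` on which the linear functional `⟪c, ·⟫` is maximized. -/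
def maxFace (P : Set (Euc d)) (c : Euc d) : Set (Euc d) :=
  {x ∈ P | ∀ y ∈ P, ⟪c, y⟫_ℝ ≤ ⟪c, x⟫_ℝ}

/-- A belt polytope: a polytope whose normal fan is the fan induced by a central
hyperplane arrangement (two functionals maximize the same face iff they have the
same sign pattern with respect to the arrangement). -/
def IsBeltPolytope (P : Set (Euc d)) : Prop :=
  IsPolytope P ∧ ∃ (k : ℕ) (z : Fin k → Euc d), (∀ i, z i ≠ 0) ∧
    ∀ c c' : Euc d,
      ((∀ i, Real.sign ⟪z i, c⟫_ℝ = Real.sign ⟪z i, c'⟫_ℝ) ↔ maxFace P c = maxFace P c')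

/-- The set of flats of a polytope: linear subspaces parallel to nonempty faces,
ordered by inclusion (as a subtype of `Submodule ℝ (Euc d)`). -/
def Flats (P : Set (Euc d)) : Set (Submodule ℝ (Euc d)) :=
  {L | ∃ F : Set (Euc d), IsFace P F ∧ F.Nonempty ∧ L = vectorSpan ℝ F}

/-- Strictly increasing chains from `a` to `c` in a poset, encoded as lists. -/
def chainsFromTo {β : Type*} [Preorder β] (a c : β) : Set (List β) :=
  {l | l.Chain' (· < ·) ∧ l.head? = some a ∧ l.getLast? = some c}

/-- The Möbius function of a poset, via Philip Hall's chain formula. -/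
def mob {β : Type*} [Preorder β] (a c : β) : ℝ :=
  ∑ᶠ l ∈ chainsFromTo a c, (-1 : ℝ) ^ (l.length + 1)

/-- Whitney numbers of the first kind of a ranked poset with minimum `bot`. -/
def whitney1 {β : Type*} [Preorder β] (rk : β → ℕ) (bot : β) (i : ℕ) : ℝ :=
  ∑ᶠ a ∈ {a : β | rk a = i}, mob bot a

/-- Flag-Whitney numbers of the second kind: the number of chains with rank set `S`. -/
def flagW2 {β : Type*} [Preorder β] (rk : β → ℕ) (S : Finset ℕ) : ℕ :=
  Nat.card {l : List β // l.Chain' (· < ·) ∧ l.map rk = S.sort (· ≤ ·)}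

/-- Flag-Whitney numbers of the first kind:
`w_S = Σ μ(0̂,c₁) μ(c₁,c₂) ⋯ μ(c_{k-1},c_k)` over chains with rank set `S`. -/
def flagW1 {β : Type*} [Preorder β] (rk : β → ℕ) (bot : β) (S : Finset ℕ) : ℝ :=
  ∑ᶠ l ∈ {l : List β | l.Chain' (· < ·) ∧ l.map rk = S.sort (· ≤ ·)},
    (List.zipWith mob (bot :: l) l).prod

/-- Chains of nonempty faces of `P` whose dimensions are exactly the set `S`. -/
def faceChains (P : Set (Euc d)) (S : Finset ℕ) : Set (List (Set (Euc d))) :=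
  {l | (∀ F ∈ l, IsFace P F ∧ F.Nonempty) ∧ l.Chain' (· ⊂ ·) ∧ l.map sdim = S.sort (· ≤ ·)}

/-- The interior flag-angle `α̂_S(P) = Σ α̂(F₁,F₂) α̂(F₂,F₃) ⋯ α̂(F_k,P)`. -/
def intFlag (α : ConeAngle d) (P : Set (Euc d)) (S : Finset ℕ) : ℝ :=
  ∑ᶠ l ∈ faceChains P S, (List.zipWith (intAngle α) l (l.drop 1 ++ [P])).prod

/-- The exterior flag-angle `α̌_S(P) = Σ α̌(F₁,F₂) α̌(F₂,F₃) ⋯ α̌(F_k,P)`. -/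
def extFlag (α : ConeAngle d) (P : Set (Euc d)) (S : Finset ℕ) : ℝ :=
  ∑ᶠ l ∈ faceChains P S, (List.zipWith (extAngle α) l (l.drop 1 ++ [P])).prod

/-- Membership in the incidence algebra: vanishing off the order relation. -/
def memIA {β : Type*} [Preorder β] (h : β → β → ℝ) : Prop :=
  ∀ a c, ¬ a ≤ c → h a c = 0

/-- Convolution product of the incidence algebra. -/
def conv {β : Type*} [Preorder β] (g h : β → β → ℝ) (a c : β) : ℝ :=
  ∑ᶠ (b : β) (_ : a ≤ b ∧ b ≤ c), g a b * h b c

/-- The product `∗_k`, summing over middle elements of rank `k`. -/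
def convk {β : Type*} (rk : β → ℕ) (k : ℕ) (g h : β → β → ℝ) (a c : β) : ℝ :=
  ∑ᶠ (b : β) (_ : rk b = k), g a b * h b c

/-- The pushforward `φ_* h (q,q') = |φ⁻¹(q')|⁻¹ Σ_{p ∈ φ⁻¹(q), p' ∈ φ⁻¹(q')} h(p,p')`. -/
def pushf {β γ : Type*} (φ : β → γ) (h : β → β → ℝ) (q q' : γ) : ℝ :=
  (Nat.card {p : β // φ p = q'} : ℝ)⁻¹ *
    ∑ᶠ (p : β) (_ : φ p = q) (p' : β) (_ : φ p' = q'), h p p'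

/-- The subspace `I_φ(𝒫)`: elements whose fiberwise column sums are independent of
the representative of the target fiber. -/
def memIphi {β γ : Type*} [Preorder β] (φ : β → γ) (h : β → β → ℝ) : Prop :=
  memIA h ∧ ∀ (q : γ) (p₁ p₂ : β), φ p₁ = φ p₂ →
    (∑ᶠ (p : β) (_ : φ p = q), h p p₁) = (∑ᶠ (p : β) (_ : φ p = q), h p p₂)

open Classical in
/-- The pullback `φ^* g (p,p') = g(φ p, φ p')` for `p ≤ p'`, else `0`. -/
def pullb {β γ : Type*} [Preorder β] (φ : β → γ) (g : γ → γ → ℝ) (p p' : β) : ℝ :=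
  if p ≤ p' then g (φ p) (φ p') else 0

open Classical in
/-- The identity `δ` of the incidence algebra. -/
def deltaIA {β : Type*} (a c : β) : ℝ := if a = c then 1 else 0

end GramAngles

namespace GramAngles

section ConePart
variable {d : ℕ}

/-- Finitely generated cones as pointed-cone hulls of finite sets. -/
lemma poly_iff (C : Set (Euc d)) :
    IsPolyhedralCone C ↔ ∃ s : Set (Euc d), s.Finite ∧ C = (PointedCone.hull ℝ s : Set (Euc d)) := by
  have key : ∀ (n : ℕ) (v : Fin n → Euc d),
      {x | ∃ c : Fin n → ℝ, (∀ i, 0 ≤ c i) ∧ x = ∑ i, c i • v i}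
        = (PointedCone.hull ℝ (Set.range v) : Set (Euc d)) := by
    intro n v
    ext x
    simp only [Set.mem_ofPred_eq, SetLike.mem_coe]
    rw [PointedCone.hull, Submodule.mem_span_range_iff_exists_fun]
    constructor
    · rintro ⟨c, hc, rfl⟩
      exact ⟨fun i => ⟨c i, hc i⟩, rfl⟩
    · rintro ⟨c, rfl⟩
      exact ⟨fun i => c i, fun i => (c i).2, rfl⟩
  constructor
  · rintro ⟨n, v, rfl⟩
    exact ⟨Set.range v, Set.finite_range v, key n v⟩
  · rintro ⟨s, hs, rfl⟩
    obtain ⟨n, v, -, hv⟩ := hs.fin_param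
    exact ⟨n, v, by rw [key, hv]⟩

lemma poly_inter_half {C : Set (Euc d)} (hC : IsPolyhedralCone C) (a : Euc d) :
    IsPolyhedralCone (C ∩ {x | 0 ≤ ⟪a, x⟫_ℝ}) := by
  classical
  obtain ⟨n, v, rfl⟩ := hC
  rw [poly_iff]
  set I := {p : Fin n // 0 ≤ ⟪a, v p⟫_ℝ}
  set J := {p : Fin n // ⟪a, v p⟫_ℝ < 0}
  let u : I ⊕ (I × J) → Euc d := Sum.elim (fun i => v i.1)
    (fun q => (-⟪a, v q.2.1⟫_ℝ) • v q.1.1 + ⟪a, v q.1.1⟫_ℝ • v q.2.1)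
  refine ⟨Set.range u, Set.finite_range u, ?_⟩
  set K : PointedCone ℝ (Euc d) := PointedCone.hull ℝ (Set.range u)
  have huK : ∀ q, u q ∈ K := fun q => Submodule.subset_span ⟨q, rfl⟩
  have hsm : ∀ (c : ℝ) (x : Euc d), 0 ≤ c → x ∈ K → c • x ∈ K :=
    fun c x hc hx => PointedCone.smul_mem K hc hx
  apply Set.Subset.antisymm
  · rintro x ⟨⟨c, hc, rfl⟩, hx⟩
    simp only [Set.mem_ofPred_eq] at hx
    set yp : Euc d := ∑ i : I, c i.1 • v i.1 with hyp
    set yn : Euc d := ∑ j : J, c j.1 • v j.1 with hyn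
    have hsplit : ∑ i, c i • v i = yp + yn := by
      rw [hyp, hyn, ← Finset.sum_subtype (Finset.univ.filter fun p => 0 ≤ ⟪a, v p⟫_ℝ)
        (by simp) (fun p => c p • v p), ← Finset.sum_subtype
        (Finset.univ.filter fun p => ⟪a, v p⟫_ℝ < 0) (by simp) (fun p => c p • v p)]
      rw [← Finset.sum_filter_add_sum_filter_not Finset.univ (fun p => 0 ≤ ⟪a, v p⟫_ℝ)]
      simp only [not_le]
    set P : ℝ := ⟪a, yp⟫_ℝ with hP
    set N : ℝ := - ⟪a, yn⟫_ℝ with hN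
    have hP' : P = ∑ i : I, c i.1 * ⟪a, v i.1⟫_ℝ := by
      simp [hP, hyp, inner_sum, inner_smul_right]
    have hN' : N = ∑ j : J, c j.1 * (-⟪a, v j.1⟫_ℝ) := by
      simp [hN, hyn, inner_sum, inner_smul_right]
    have hPN : N ≤ P := by
      rw [hsplit, inner_add_right] at hx
      simp only [hP, hN]; linarith
    have hypK : yp ∈ K := by
      refine Submodule.sum_mem _ fun i _ => hsm _ _ (hc _) ?_
      exact huK (Sum.inl i)
    have hN0 : ∀ j : J, 0 ≤ c j.1 * (-⟪a, v j.1⟫_ℝ) := fun j =>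
      mul_nonneg (hc _) (by linarith [j.2])
    rw [hsplit]
    rcases eq_or_lt_of_le (show 0 ≤ N by rw [hN']; exact Finset.sum_nonneg fun j _ => hN0 j) with h0 | h0
    · have : yn = 0 := by
        rw [hyn]
        apply Finset.sum_eq_zero
        intro j hj
        have := (Finset.sum_eq_zero_iff_of_nonneg (fun j _ => hN0 j)).1 (hN' ▸ h0.symm) j hj
        have h2 : c j.1 = 0 := by
          rcases mul_eq_zero.1 this with h | h
          · exact h
          · exact absurd j.2 (by linarith)
        simp [h2]
      rw [this, add_zero]; exact hypK
    · have hP0 : 0 < P := lt_of_lt_of_le h0 hPN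
      have hmix : N • yp + P • yn ∈ K := by
        have : N • yp + P • yn = ∑ i : I, ∑ j : J, (c i.1 * c j.1) • u (Sum.inr (i, j)) := by
          rw [hN', hP', hyp, hyn, Finset.sum_smul_sum, Finset.sum_smul_sum, Finset.sum_comm,
            ← Finset.sum_add_distrib]
          refine Finset.sum_congr rfl fun i _ => ?_
          rw [← Finset.sum_add_distrib]
          refine Finset.sum_congr rfl fun j _ => ?_
          simp only [u, Sum.elim_inr]
          module
        rw [this]
        exact Submodule.sum_mem _ fun i _ => Submodule.sum_mem _ fun j _ =>
          hsm _ _ (mul_nonneg (hc _) (hc _)) (huK _)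
      have : yp + yn = (1 - N / P) • yp + (1 / P) • (N • yp + P • yn) := by
        rw [smul_add, smul_smul, smul_smul, one_div_mul_cancel hP0.ne', sub_smul]
        rw [show 1 / P * N = N / P by ring, one_smul, one_smul]
        abel
      rw [this]
      exact K.add_mem (hsm _ _ (by rw [sub_nonneg, div_le_one hP0]; exact hPN) hypK)
        (hsm _ _ (by positivity) hmix)
  · have hv : ∀ i, v i ∈ (PointedCone.hull ℝ (Set.range v)) := fun i => Submodule.subset_span ⟨i, rfl⟩
    let H : PointedCone ℝ (Euc d) :=
      { carrier := {x | (∃ c : Fin n → ℝ, (∀ i, 0 ≤ c i) ∧ x = ∑ i, c i • v i)} ∩ {x | 0 ≤ ⟪a, x⟫_ℝ}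
        add_mem' := by
          rintro x y ⟨⟨c, hc, rfl⟩, hx⟩ ⟨⟨c', hc', rfl⟩, hy⟩
          refine ⟨⟨c + c', fun i => add_nonneg (hc i) (hc' i), ?_⟩, ?_⟩
          · simp [add_smul, Finset.sum_add_distrib]
          · simp only [Set.mem_ofPred_eq] at *
            rw [inner_add_right]; linarith
        zero_mem' := ⟨⟨0, by simp, by simp⟩, by simp⟩
        smul_mem' := by
          rintro ⟨r, hr⟩ x ⟨⟨c, hc, rfl⟩, hx⟩
          refine ⟨⟨fun i => r * c i, fun i => mul_nonneg hr (hc i), ?_⟩, ?_⟩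
          · show r • (∑ i, c i • v i) = _
            simp [Finset.smul_sum, smul_smul]
          · show 0 ≤ ⟪a, r • _⟫_ℝ
            rw [inner_smul_right]
            exact mul_nonneg hr hx }
    have : K ≤ H := by
      apply Submodule.span_le.2
      rintro _ ⟨q, rfl⟩
      rcases q with i | ⟨i, j⟩
      · refine ⟨⟨Pi.single i.1 1, fun k => ?_, ?_⟩, i.2⟩
        · by_cases h : k = i.1
          · subst h; simp
          · simp [h]
        · simp [Pi.single_apply, u]
      · have h1 := i.2
        have h2 := j.2
        refine ⟨⟨Pi.single i.1 (-⟪a, v j.1⟫_ℝ) + Pi.single j.1 ⟪a, v i.1⟫_ℝ, fun k => ?_, ?_⟩, ?_⟩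
        · rw [Pi.add_apply]
          apply add_nonneg
          · rw [Pi.single_apply]; split_ifs <;> linarith
          · rw [Pi.single_apply]; split_ifs <;> linarith
        · simp [Pi.single_apply, u, add_smul, Finset.sum_add_distrib]
        · simp only [u, Sum.elim_inr, Set.mem_ofPred_eq, inner_add_right, inner_smul_right]
          apply le_of_eq; ring
    exact this

/-- Cones given by finitely many inequalities. -/
def hcone (A : Finset (Euc d)) : Set (Euc d) := {x | ∀ a ∈ A, 0 ≤ ⟪a, x⟫_ℝ}

lemma poly_inter_hcone {C : Set (Euc d)} (hC : IsPolyhedralCone C) (A : Finset (Euc d)) :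
    IsPolyhedralCone (C ∩ hcone A) := by
  classical
  induction A using Finset.induction_on with
  | empty => simpa [hcone] using hC
  | insert a A _ ih =>
    have := poly_inter_half ih a
    convert this using 1
    ext x
    simp only [hcone, Set.mem_inter_iff, Set.mem_ofPred_eq, Finset.mem_insert, forall_eq_or_imp]
    tauto

lemma poly_univ : IsPolyhedralCone (Set.univ : Set (Euc d)) := by
  rw [poly_iff]
  let b := (EuclideanSpace.basisFun (Fin d) ℝ).toBasis
  refine ⟨Set.range b ∪ Set.range (fun i => - b i),
    (Set.finite_range _).union (Set.finite_range _), ?_⟩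
  symm
  rw [Set.eq_univ_iff_forall]
  intro x
  set K : PointedCone ℝ (Euc d) := PointedCone.hull ℝ (Set.range b ∪ Set.range (fun i => - b i))
  have hsm : ∀ (c : ℝ) (x : Euc d), 0 ≤ c → x ∈ K → c • x ∈ K :=
    fun c x hc hx => PointedCone.smul_mem K hc hx
  rw [← b.sum_repr x]
  refine Submodule.sum_mem _ fun i _ => ?_
  rcases le_total 0 (b.repr x i) with h | h
  · exact hsm _ _ h (Submodule.subset_span (Or.inl ⟨i, rfl⟩))
  · have := hsm (-(b.repr x i)) (- b i) (by linarith) (Submodule.subset_span (Or.inr ⟨i, rfl⟩))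
    simpa using this

lemma poly_hcone (A : Finset (Euc d)) : IsPolyhedralCone (hcone A) := by
  simpa using poly_inter_hcone poly_univ A

lemma poly_hrep {C : Set (Euc d)} (hC : IsPolyhedralCone C) : ∃ A : Finset (Euc d), C = hcone A := by
  classical
  obtain ⟨s, hs, rfl⟩ := (poly_iff C).1 hC
  clear hC
  induction s, hs using Set.Finite.induction_on with
  | empty =>
    let b := (EuclideanSpace.basisFun (Fin d) ℝ).toBasis
    refine ⟨Finset.univ.image b ∪ Finset.univ.image (fun i => - b i), ?_⟩
    ext x
    simp only [PointedCone.hull, Submodule.span_empty, hcone]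
    constructor
    · intro hx
      have : x = 0 := by simpa using hx
      subst this; simp
    · intro hx
      have : x = 0 := by
        ext i
        have h1 := hx (b i) (by simp)
        have h2 := hx (- b i) (by simp)
        simp only [b, OrthonormalBasis.coe_toBasis, inner_neg_left,
          EuclideanSpace.basisFun_apply, EuclideanSpace.inner_single_left] at h1 h2
        simp only [map_one, one_mul] at h1 h2
        have : x i = 0 := by linarith
        simpa using this
      subst this; simp
  | @insert g s _ _ ih =>
    obtain ⟨A, hA⟩ := ih
    refine ⟨(A.filter fun a => 0 ≤ ⟪a, g⟫_ℝ) ∪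
      (((A.filter fun a => 0 < ⟪a, g⟫_ℝ) ×ˢ (A.filter fun a => ⟪a, g⟫_ℝ < 0)).image
        fun q => ⟪q.1, g⟫_ℝ • q.2 - ⟪q.2, g⟫_ℝ • q.1), ?_⟩
    have hmem : ∀ x, x ∈ PointedCone.hull ℝ s ↔ ∀ a ∈ A, 0 ≤ ⟪a, x⟫_ℝ := fun x => by
      have := Set.ext_iff.1 hA x
      exact this
    ext x
    simp only [SetLike.mem_coe]
    rw [PointedCone.hull, Submodule.mem_span_insert]
    constructor
    · rintro ⟨⟨t, ht⟩, y, hy, rfl⟩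
      have hy' := (hmem y).1 hy
      have hsm : ∀ a : Euc d, ⟪a, (⟨t, ht⟩ : {c : ℝ // 0 ≤ c}) • g + y⟫_ℝ = t * ⟪a, g⟫_ℝ + ⟪a, y⟫_ℝ := by
        intro a
        rw [inner_add_right]
        congr 1
        exact inner_smul_right _ _ _
      intro a ha
      rw [hsm]
      rcases Finset.mem_union.1 ha with ha | ha
      · rw [Finset.mem_filter] at ha
        have := hy' a ha.1
        have := mul_nonneg ht ha.2
        linarith
      · obtain ⟨⟨p, q⟩, hpq, rfl⟩ := Finset.mem_image.1 ha
        simp only [Finset.mem_product, Finset.mem_filter] at hpq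
        obtain ⟨⟨hp, hp'⟩, hq, hq'⟩ := hpq
        simp only [inner_sub_left, real_inner_smul_left]
        have h1 := mul_nonneg hp'.le (hy' q hq)
        have h2 := mul_nonneg (neg_nonneg.2 hq'.le) (hy' p hp)
        nlinarith
    · intro hx
      -- choose the largest lower bound
      let f : Euc d → ℝ := fun b => if ⟪b, g⟫_ℝ < 0 then ⟪b, x⟫_ℝ / ⟪b, g⟫_ℝ else 0
      obtain ⟨b, hb, hbmax⟩ := Finset.exists_max_image (insert 0 A) f (Finset.insert_nonempty _ _)
      have hf0 : f 0 = 0 := by simp [f]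
      have ht : 0 ≤ f b := by rw [← hf0]; exact hbmax 0 (Finset.mem_insert_self _ _)
      refine ⟨⟨f b, ht⟩, x - f b • g, (hmem _).2 ?_, ?_⟩
      · intro a ha
        rw [inner_sub_right, inner_smul_right]
        rcases lt_trichotomy ⟪a, g⟫_ℝ 0 with h | h | h
        · have h1 := hbmax a (Finset.mem_insert_of_mem ha)
          have h2 : f a = ⟪a, x⟫_ℝ / ⟪a, g⟫_ℝ := if_pos h
          rw [h2, div_le_iff_of_neg h] at h1
          linarith
        · have := hx a (Finset.mem_union_left _ (Finset.mem_filter.2 ⟨ha, h.ge⟩))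
          rw [h]; linarith
        · have h1 := hx a (Finset.mem_union_left _ (Finset.mem_filter.2 ⟨ha, h.le⟩))
          by_cases hbg : ⟪b, g⟫_ℝ < 0
          · have hbA : b ∈ A := by
              rcases Finset.mem_insert.1 hb with h' | h'
              · subst h'; simp at hbg
              · exact h'
            have h2 := hx (⟪a, g⟫_ℝ • b - ⟪b, g⟫_ℝ • a) (Finset.mem_union_right _
              (Finset.mem_image.2 ⟨(a, b), by simp [ha, h, hbA, hbg], rfl⟩))
            simp only [inner_sub_left, real_inner_smul_left] at h2
            have h3 : f b = ⟪b, x⟫_ℝ / ⟪b, g⟫_ℝ := if_pos hbg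
            have h4 : f b * ⟪a, g⟫_ℝ ≤ ⟪a, x⟫_ℝ := by
              rw [h3, div_mul_eq_mul_div, div_le_iff_of_neg hbg]
              linarith
            linarith
          · have h3 : f b = 0 := if_neg hbg
            rw [h3]; linarith
      · show x = f b • g + (x - f b • g)
        simp

lemma sdim_lt_of_orth {X : Set (Euc d)} {a : Euc d} (ha : a ≠ 0) (h : ∀ x ∈ X, ⟪a, x⟫_ℝ = 0) :
    sdim X < d := by
  have h1 : vectorSpan ℝ X ≤ (Submodule.span ℝ {a})ᗮ := by
    rw [vectorSpan_def, Submodule.span_le]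
    rintro _ ⟨x, hx, y, hy, rfl⟩
    rw [SetLike.mem_coe, Submodule.mem_orthogonal_singleton_iff_inner_right]
    simp [inner_sub_right, h x hx, h y hy]
  have h2 : vectorSpan ℝ X < ⊤ := by
    refine lt_of_le_of_ne le_top fun h => ?_
    rw [h, top_le_iff] at h1
    have : a ∈ (Submodule.span ℝ {a})ᗮ := h1 ▸ Submodule.mem_top
    rw [Submodule.mem_orthogonal_singleton_iff_inner_right] at this
    exact ha (inner_self_eq_zero.1 this)
  have := Submodule.finrank_lt_finrank_of_lt h2
  simpa [sdim] using this

lemma sdim_mono {X Y : Set (Euc d)} (h : X ⊆ Y) : sdim X ≤ sdim Y :=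
  Submodule.finrank_mono (vectorSpan_mono ℝ h)

lemma alpha_split (α : ConeAngle d) {X : Set (Euc d)} (hX : IsPolyhedralCone X) {a : Euc d} (ha : a ≠ 0) :
    α.toFun X = α.toFun (X ∩ {x | 0 ≤ ⟪a, x⟫_ℝ}) + α.toFun (X ∩ {x | 0 ≤ ⟪-a, x⟫_ℝ}) := by
  have h1 := poly_inter_half hX a
  have h2 := poly_inter_half hX (-a)
  have hu : (X ∩ {x | 0 ≤ ⟪a, x⟫_ℝ}) ∪ (X ∩ {x | 0 ≤ ⟪-a, x⟫_ℝ}) = X := by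
    ext x
    simp only [Set.mem_union, Set.mem_inter_iff, Set.mem_ofPred_eq, inner_neg_left]
    rcases le_total 0 ⟪a, x⟫_ℝ with h | h
    · tauto
    · have : 0 ≤ - ⟪a, x⟫_ℝ := by linarith
      tauto
  have hi : (X ∩ {x | 0 ≤ ⟪a, x⟫_ℝ}) ∩ (X ∩ {x | 0 ≤ ⟪-a, x⟫_ℝ}) =
      (X ∩ {x | 0 ≤ ⟪a, x⟫_ℝ}) ∩ {x | 0 ≤ ⟪-a, x⟫_ℝ} := by
    ext x; simp only [Set.mem_inter_iff]; tauto
  have h3 := poly_inter_half h1 (-a)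
  have h4 := α.union' _ _ h1 h2 (hu.symm ▸ hX) (hi.symm ▸ h3)
  rw [hu, hi, α.simple' _ h3] at h4
  · linarith
  · apply sdim_lt_of_orth ha
    rintro x ⟨⟨-, hx⟩, hx'⟩
    simp only [Set.mem_ofPred_eq, inner_neg_left] at hx hx'
    linarith

open Classical in
lemma alpha_base (α : ConeAngle d) {J : Type*} (Js : Finset J) (k : J → ℝ) (A : J → Finset (Euc d))
    (B : Finset (Euc d)) (K : ℝ) (hAB : ∀ j ∈ Js, A j ⊆ B)
    (h : ∀ v : Euc d, (∀ a ∈ B, a ≠ 0 → ⟪a, v⟫_ℝ ≠ 0) →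
      ∑ j ∈ Js, k j * (if v ∈ hcone (A j) then 1 else 0) = K)
    (R : Set (Euc d)) (hR : IsPolyhedralCone R)
    (hs : ∀ a ∈ B, (∀ x ∈ R, 0 ≤ ⟪a, x⟫_ℝ) ∨ (∀ x ∈ R, ⟪a, x⟫_ℝ ≤ 0)) :
    ∑ j ∈ Js, k j * α.toFun (R ∩ hcone (A j)) = K * α.toFun R := by
  by_cases hdim : sdim R < d
  · rw [α.simple' R hR hdim, mul_zero]
    apply Finset.sum_eq_zero
    intro j _
    rw [α.simple' _ (poly_inter_hcone hR _) (lt_of_le_of_lt (sdim_mono Set.inter_subset_left) hdim),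
      mul_zero]
  obtain ⟨n, g, hg⟩ := id hR
  have hgR : ∀ i, g i ∈ R := by
    intro i
    rw [hg]
    refine ⟨Pi.single i 1, fun j => ?_, by simp [Pi.single_apply]⟩
    rw [Pi.single_apply]; split_ifs <;> norm_num
  set v0 := ∑ i, g i with hv0
  have hv0R : v0 ∈ R := by
    rw [hg]; exact ⟨fun _ => 1, by simp, by simp [hv0]⟩
  have hgen : ∀ a ∈ B, a ≠ 0 → ⟪a, v0⟫_ℝ ≠ 0 := by
    intro a ha ha0 h0
    apply hdim
    apply sdim_lt_of_orth ha0
    have hz : ∀ i, ⟪a, g i⟫_ℝ = 0 := by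
      rw [hv0, inner_sum] at h0
      intro i
      rcases hs a ha with h | h
      · exact (Finset.sum_eq_zero_iff_of_nonneg (fun i _ => h _ (hgR i))).1 h0 i (Finset.mem_univ _)
      · exact (Finset.sum_eq_zero_iff_of_nonpos (fun i _ => h _ (hgR i))).1 h0 i (Finset.mem_univ _)
    intro x hx
    rw [hg] at hx
    obtain ⟨c, -, rfl⟩ := hx
    simp [inner_sum, inner_smul_right, hz]
  rw [← h v0 hgen, Finset.sum_mul]
  refine Finset.sum_congr rfl fun j hj => ?_
  rw [mul_assoc]
  congr 1
  split_ifs with hc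
  · rw [one_mul]
    congr 1
    apply Set.inter_eq_left.2
    intro x hx a ha
    by_cases ha0 : a = 0
    · simp [ha0]
    rcases hs a (hAB j hj ha) with h' | h'
    · exact h' x hx
    · exact absurd (le_antisymm (h' v0 hv0R) (hc a ha)) (hgen a (hAB j hj ha) ha0)
  · rw [zero_mul]
    simp only [hcone, Set.mem_ofPred_eq, not_forall, not_le] at hc
    obtain ⟨a, ha, hneg⟩ := hc
    have ha0 : a ≠ 0 := by rintro rfl; simp at hneg
    apply α.simple' _ (poly_inter_hcone hR _)
    apply sdim_lt_of_orth ha0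
    rintro x ⟨hx, hx'⟩
    rcases hs a (hAB j hj ha) with h' | h'
    · exact absurd (h' v0 hv0R) (not_le.2 hneg)
    · exact le_antisymm (h' x hx) (hx' a ha)

open Classical in
lemma alpha_rec (α : ConeAngle d) {J : Type*} (Js : Finset J) (k : J → ℝ) (A : J → Finset (Euc d))
    (B : Finset (Euc d)) (K : ℝ) (hAB : ∀ j ∈ Js, A j ⊆ B)
    (h : ∀ v : Euc d, (∀ a ∈ B, a ≠ 0 → ⟪a, v⟫_ℝ ≠ 0) →
      ∑ j ∈ Js, k j * (if v ∈ hcone (A j) then 1 else 0) = K)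
    (D : Finset (Euc d)) : ∀ (R : Set (Euc d)), IsPolyhedralCone R → 
    (∀ a ∈ B, a ∉ D → (∀ x ∈ R, 0 ≤ ⟪a, x⟫_ℝ) ∨ (∀ x ∈ R, ⟪a, x⟫_ℝ ≤ 0)) →
    ∑ j ∈ Js, k j * α.toFun (R ∩ hcone (A j)) = K * α.toFun R := by
  induction D using Finset.induction_on with
  | empty =>
    intro R hR hs
    exact alpha_base α Js k A B K hAB h R hR fun a ha => hs a ha (by simp)
  | insert b D _ ih =>
    intro R hR hs
    by_cases hb : b = 0
    · apply ih R hR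
      intro a ha haD
      by_cases hab : a = b
      · left; subst hab; simp [hb]
      · exact hs a ha (by simp [hab, haD])
    have e1 := ih (R ∩ {x | 0 ≤ ⟪b, x⟫_ℝ}) (poly_inter_half hR b) (by
      intro a ha haD
      by_cases hab : a = b
      · left; subst hab; exact fun x hx => hx.2
      · exact (hs a ha (by simp [hab, haD])).imp (fun h x hx => h x hx.1) (fun h x hx => h x hx.1))
    have e2 := ih (R ∩ {x | 0 ≤ ⟪-b, x⟫_ℝ}) (poly_inter_half hR (-b)) (by
      intro a ha haD
      by_cases hab : a = b
      · right; subst hab; intro x hx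
        have := hx.2
        simp only [Set.mem_ofPred_eq, inner_neg_left] at this
        linarith
      · exact (hs a ha (by simp [hab, haD])).imp (fun h x hx => h x hx.1) (fun h x hx => h x hx.1))
    rw [alpha_split α hR hb, mul_add, ← e1, ← e2, ← Finset.sum_add_distrib]
    refine Finset.sum_congr rfl fun j _ => ?_
    rw [alpha_split α (poly_inter_hcone hR (A j)) hb, mul_add, Set.inter_right_comm,
      Set.inter_right_comm R _ {x | 0 ≤ ⟪-b, x⟫_ℝ}]

open Classical in
/-- Linear relations that hold pointwise off finitely many hyperplanes hold for cone angles. -/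
lemma alpha_sum (α : ConeAngle d) {J : Type*} (Js : Finset J) (k : J → ℝ) (C : J → Set (Euc d))
    (hC : ∀ j ∈ Js, IsPolyhedralCone (C j)) (B : Finset (Euc d)) (K : ℝ)
    (h : ∀ v : Euc d, (∀ a ∈ B, a ≠ 0 → ⟪a, v⟫_ℝ ≠ 0) →
      ∑ j ∈ Js, k j * (if v ∈ C j then 1 else 0) = K) :
    ∑ j ∈ Js, k j * α.toFun (C j) = K := by
  have : ∀ j, ∃ A : Finset (Euc d), j ∈ Js → C j = hcone A := by
    intro j
    by_cases hj : j ∈ Js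
    · obtain ⟨A, hA⟩ := poly_hrep (hC j hj)
      exact ⟨A, fun _ => hA⟩
    · exact ⟨∅, fun h => absurd h hj⟩
  choose A hA using this
  have := alpha_rec α Js k A (B ∪ Js.biUnion A) K
    (fun j hj => (Finset.subset_biUnion_of_mem A hj).trans Finset.subset_union_right)
    (by
      intro v hv
      rw [← h v fun a ha => hv a (Finset.mem_union_left _ ha)]
      refine Finset.sum_congr rfl fun j hj => ?_
      rw [hA j hj])
    (B ∪ Js.biUnion A) Set.univ poly_univ (fun a ha hn => absurd ha hn)
  rw [α.norm', mul_one] at this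
  rw [← this]
  refine Finset.sum_congr rfl fun j hj => ?_
  rw [Set.univ_inter, hA j hj]

end ConePart

section EulerPart
variable {d : ℕ}

/-- A relatively open cell of a hyperplane arrangement in `Wᗮ`. -/
def cell (W : Submodule ℝ (Euc d)) (l : List (Euc d × SignType)) : Set (Euc d) :=
  {c | c ∈ Wᗮ ∧ ∀ p ∈ l, SignType.sign ⟪p.1, c⟫_ℝ = p.2}

/-- The span of the normals vanishing on a cell. -/
def zsp (W : Submodule ℝ (Euc d)) (l : List (Euc d × SignType)) : Submodule ℝ (Euc d) :=
  W ⊔ Submodule.span ℝ {w | (w, (0 : SignType)) ∈ l}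

open Classical in
/-- The signed indicator of nonemptiness of a cell. -/
def eps (W : Submodule ℝ (Euc d)) (l : List (Euc d × SignType)) : ℝ :=
  if (cell W l).Nonempty then (-1) ^ Module.finrank ℝ (zsp W l) else 0

lemma mem_cell_cons {W : Submodule ℝ (Euc d)} {l : List (Euc d × SignType)} {w : Euc d}
    {σ : SignType} {c : Euc d} :
    c ∈ cell W ((w, σ) :: l) ↔ c ∈ cell W l ∧ SignType.sign ⟪w, c⟫_ℝ = σ := by
  simp only [cell, Set.mem_ofPred_eq, List.mem_cons, forall_eq_or_imp]
  tauto

lemma zsp_cons_ne {W : Submodule ℝ (Euc d)} {l : List (Euc d × SignType)} {w : Euc d}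
    {σ : SignType} (h : σ ≠ 0) : zsp W ((w, σ) :: l) = zsp W l := by
  have : {x | (x, (0 : SignType)) ∈ (w, σ) :: l} = {x | (x, (0 : SignType)) ∈ l} := by
    ext x
    simp only [Set.mem_ofPred_eq, List.mem_cons, Prod.mk.injEq]
    constructor
    · rintro (⟨-, h'⟩ | h')
      · exact absurd h'.symm h
      · exact h'
    · exact Or.inr
  rw [zsp, zsp, this]

lemma zsp_cons_zero {W : Submodule ℝ (Euc d)} {l : List (Euc d × SignType)} {w : Euc d} :
    zsp W ((w, 0) :: l) = Submodule.span ℝ {w} ⊔ zsp W l := by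
  have : {x | (x, (0 : SignType)) ∈ (w, 0) :: l} = {w} ∪ {x | (x, (0 : SignType)) ∈ l} := by
    ext x
    simp
  rw [zsp, zsp, this, Submodule.span_union]
  rw [sup_left_comm]

lemma cell_orth {W : Submodule ℝ (Euc d)} {l : List (Euc d × SignType)} {c : Euc d}
    (hc : c ∈ cell W l) : c ∈ (zsp W l)ᗮ := by
  rw [zsp, ← Submodule.inf_orthogonal]
  refine ⟨hc.1, ?_⟩
  rw [SetLike.mem_coe, Submodule.mem_orthogonal]
  intro u hu
  induction hu using Submodule.span_induction with
  | mem x hx => simpa using hc.2 _ hx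
  | zero => simp
  | add x y _ _ hx hy => rw [inner_add_left, hx, hy, add_zero]
  | smul a x _ hx => rw [real_inner_smul_left, hx, mul_zero]

lemma cell_open {W : Submodule ℝ (Euc d)} {l : List (Euc d × SignType)} {c u : Euc d}
    (hc : c ∈ cell W l) (hu : u ∈ (zsp W l)ᗮ) :
    ∀ᶠ t in nhds (0 : ℝ), c + t • u ∈ cell W l := by
  have hW : u ∈ Wᗮ := Submodule.orthogonal_le le_sup_left hu
  have h1 : ∀ᶠ t in nhds (0 : ℝ), ∀ p ∈ {p | p ∈ l}, SignType.sign ⟪p.1, c + t • u⟫_ℝ = p.2 := by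
    rw [Filter.eventually_all_finite (List.finite_toSet l)]
    rintro ⟨w, σ⟩ hp
    have hs := hc.2 _ hp
    simp only at hs ⊢
    have hcont : Continuous fun t : ℝ => ⟪w, c + t • u⟫_ℝ := by fun_prop
    have ht : Filter.Tendsto (fun t : ℝ => ⟪w, c + t • u⟫_ℝ) (nhds 0) (nhds ⟪w, c⟫_ℝ) := by
      have := hcont.tendsto 0
      simpa using this
    rcases lt_trichotomy ⟪w, c⟫_ℝ 0 with h | h | h
    · filter_upwards [ht.eventually (gt_mem_nhds h)] with t ht'
      rw [← hs, sign_neg h, sign_neg ht']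
    · have hσ : σ = 0 := by rw [← hs, h, sign_zero]
      subst hσ
      have hwu : ⟪w, u⟫_ℝ = 0 := by
        apply Submodule.inner_right_of_mem_orthogonal _ hu
        exact Submodule.mem_sup_right (Submodule.subset_span hp)
      refine Filter.Eventually.of_forall fun t => ?_
      rw [inner_add_right, inner_smul_right, hwu, h]; simp
    · filter_upwards [ht.eventually (lt_mem_nhds h)] with t ht'
      rw [← hs, sign_pos h, sign_pos ht']
  filter_upwards [h1] with t ht
  exact ⟨Submodule.add_mem _ hc.1 (Submodule.smul_mem _ _ hW), ht⟩

lemma cell_comb {W : Submodule ℝ (Euc d)} {l : List (Euc d × SignType)} {c c' : Euc d}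
    (hc : c ∈ cell W l) (hc' : c' ∈ cell W l) {a b : ℝ} (ha : 0 < a) (hb : 0 < b) :
    a • c + b • c' ∈ cell W l := by
  refine ⟨Submodule.add_mem _ (Submodule.smul_mem _ _ hc.1) (Submodule.smul_mem _ _ hc'.1), ?_⟩
  rintro ⟨w, σ⟩ hp
  have h1 := hc.2 _ hp
  have h2 := hc'.2 _ hp
  simp only at h1 h2 ⊢
  rw [inner_add_right, inner_smul_right, inner_smul_right]
  rcases lt_trichotomy ⟪w, c⟫_ℝ 0 with h | h | h
  · rw [sign_neg h] at h1
    rw [← h1, sign_eq_neg_one_iff] at h2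
    rw [← h1, sign_eq_neg_one_iff]
    nlinarith
  · rw [h, sign_zero] at h1
    rw [← h1, sign_eq_zero_iff] at h2
    rw [← h1, h, h2]; simp
  · rw [sign_pos h] at h1
    rw [← h1, sign_eq_one_iff] at h2
    rw [← h1, sign_eq_one_iff]
    positivity

lemma eps_step (W : Submodule ℝ (Euc d)) (l : List (Euc d × SignType)) (w : Euc d) :
    ∑ σ : SignType, eps W ((w, σ) :: l) = eps W l := by
  classical
  have hsum : ∑ σ : SignType, eps W ((w, σ) :: l) =
      eps W ((w, 0) :: l) + eps W ((w, -1) :: l) + eps W ((w, 1) :: l) := by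
    rw [SignType.univ_eq]
    rw [Finset.sum_insert (by decide), Finset.sum_insert (by decide), Finset.sum_singleton]
    ring
  rw [hsum]
  have hsub : ∀ σ, (cell W ((w, σ) :: l)).Nonempty → (cell W l).Nonempty := by
    rintro σ ⟨c, hc⟩
    exact ⟨c, (mem_cell_cons.1 hc).1⟩
  by_cases hne : (cell W l).Nonempty
  swap
  · simp only [eps, hne, if_false]
    rw [if_neg fun h => hne (hsub _ h), if_neg fun h => hne (hsub _ h),
      if_neg fun h => hne (hsub _ h)]
    simp
  obtain ⟨c, hc⟩ := id hne
  simp only [eps]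
  rw [zsp_cons_ne (by decide : (-1 : SignType) ≠ 0), zsp_cons_ne (by decide : (1 : SignType) ≠ 0),
    zsp_cons_zero, if_pos hne]
  by_cases hw : w ∈ zsp W l
  · have h0 : ∀ c ∈ cell W l, ⟪w, c⟫_ℝ = 0 := fun c hc =>
      Submodule.inner_right_of_mem_orthogonal hw (cell_orth hc)
    rw [if_pos ⟨c, mem_cell_cons.2 ⟨hc, by rw [h0 c hc, sign_zero]⟩⟩, if_neg, if_neg]
    · rw [sup_eq_right.2 ((Submodule.span_singleton_le_iff_mem _ _).2 hw)]; simp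
    · rintro ⟨c', hc'⟩
      have hc1 := (mem_cell_cons.1 hc').1
      rw [mem_cell_cons, h0 c' hc1, sign_zero] at hc'
      exact absurd hc'.2 (by decide)
    · rintro ⟨c', hc'⟩
      have hc1 := (mem_cell_cons.1 hc').1
      rw [mem_cell_cons, h0 c' hc1, sign_zero] at hc'
      exact absurd hc'.2 (by decide)
  · have hrk : Module.finrank ℝ (Submodule.span ℝ {w} ⊔ zsp W l : Submodule ℝ (Euc d)) =
        Module.finrank ℝ (zsp W l) + 1 := by
      have hw0 : w ≠ 0 := fun h => hw (h ▸ Submodule.zero_mem _)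
      have h1 := Submodule.finrank_sup_add_finrank_inf_eq (Submodule.span ℝ {w}) (zsp W l)
      have h2 : Submodule.span ℝ {w} ⊓ zsp W l = ⊥ :=
        ((Submodule.disjoint_span_singleton' hw0).2 hw).symm.eq_bot
      rw [h2, finrank_span_singleton hw0, finrank_bot] at h1
      omega
    rw [hrk]
    obtain ⟨u, hu, hwu⟩ : ∃ u ∈ (zsp W l)ᗮ, 0 < ⟪w, u⟫_ℝ := by
      by_contra hcon
      push Not at hcon
      apply hw
      rw [← Submodule.orthogonal_orthogonal (zsp W l), Submodule.mem_orthogonal']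
      intro u hu
      apply le_antisymm (hcon u hu)
      have := hcon (-u) (Submodule.neg_mem _ hu)
      rw [inner_neg_right] at this
      linarith
    have hz : (cell W ((w, 0) :: l)).Nonempty →
        (cell W ((w, -1) :: l)).Nonempty ∧ (cell W ((w, 1) :: l)).Nonempty := by
      rintro ⟨c, hc⟩
      rw [mem_cell_cons, sign_eq_zero_iff] at hc
      constructor
      · have := (cell_open hc.1 (Submodule.neg_mem _ hu)).filter_mono
          (nhdsWithin_le_nhds (s := Set.Ioi 0))
        obtain ⟨t, ht, ht0⟩ := (this.and self_mem_nhdsWithin).exists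
        refine ⟨_, mem_cell_cons.2 ⟨ht, ?_⟩⟩
        rw [sign_eq_neg_one_iff, inner_add_right, hc.2, inner_smul_right, inner_neg_right]
        have := mul_pos (show 0 < t from ht0) hwu
        linarith
      · have := (cell_open hc.1 hu).filter_mono
          (nhdsWithin_le_nhds (s := Set.Ioi 0))
        obtain ⟨t, ht, ht0⟩ := (this.and self_mem_nhdsWithin).exists
        refine ⟨_, mem_cell_cons.2 ⟨ht, ?_⟩⟩
        rw [sign_eq_one_iff, inner_add_right, hc.2, inner_smul_right]
        have := mul_pos (show 0 < t from ht0) hwu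
        linarith
    have hpm : (cell W ((w, -1) :: l)).Nonempty → (cell W ((w, 1) :: l)).Nonempty →
        (cell W ((w, 0) :: l)).Nonempty := by
      rintro ⟨c1, hc1⟩ ⟨c2, hc2⟩
      rw [mem_cell_cons, sign_eq_neg_one_iff] at hc1
      rw [mem_cell_cons, sign_eq_one_iff] at hc2
      refine ⟨_, mem_cell_cons.2 ⟨cell_comb hc1.1 hc2.1 hc2.2 (neg_pos.2 hc1.2), ?_⟩⟩
      rw [sign_eq_zero_iff, inner_add_right, inner_smul_right, inner_smul_right]
      ring
    have hor : (cell W ((w, 0) :: l)).Nonempty ∨ (cell W ((w, -1) :: l)).Nonempty ∨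
        (cell W ((w, 1) :: l)).Nonempty := by
      rcases lt_trichotomy ⟪w, c⟫_ℝ 0 with h | h | h
      · exact Or.inr (Or.inl ⟨c, mem_cell_cons.2 ⟨hc, sign_neg h⟩⟩)
      · exact Or.inl ⟨c, mem_cell_cons.2 ⟨hc, by rw [h, sign_zero]⟩⟩
      · exact Or.inr (Or.inr ⟨c, mem_cell_cons.2 ⟨hc, sign_pos h⟩⟩)
    rw [pow_succ]
    by_cases h1 : (cell W ((w, 0) :: l)).Nonempty
    · obtain ⟨h2, h3⟩ := hz h1
      simp only [h1, h2, h3, if_true]; ring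
    · by_cases h2 : (cell W ((w, -1) :: l)).Nonempty
      · have h3 : ¬ (cell W ((w, 1) :: l)).Nonempty := fun h3 => h1 (hpm h2 h3)
        simp only [h1, h2, h3, if_true, if_false]; ring
      · have h3 : (cell W ((w, 1) :: l)).Nonempty := by tauto
        simp only [h1, h2, h3, if_true, if_false]; ring

lemma eps_sum (W : Submodule ℝ (Euc d)) (l : List (Euc d × SignType)) :
    ∀ (n : ℕ) (z : Fin n → Euc d),
      ∑ s : Fin n → SignType, eps W (List.ofFn (fun i => (z i, s i)) ++ l) = eps W l := by
  intro n
  induction n with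
  | zero => intro z; simp
  | succ n ih =>
    intro z
    rw [← (Fin.consEquiv (fun _ => SignType)).sum_comp, Fintype.sum_prod_type, Finset.sum_comm,
      ← ih (fun i => z i.succ)]
    refine Finset.sum_congr rfl fun s _ => ?_
    rw [← eps_step W _ (z 0)]
    refine Finset.sum_congr rfl fun σ _ => ?_
    simp [List.ofFn_succ]

/-- Span of the generators on which a sign vector vanishes. -/
def zspan {n : ℕ} (z : Fin n → Euc d) (s : Fin n → SignType) : Submodule ℝ (Euc d) :=
  Submodule.span ℝ (z '' {i | s i = 0})

/-- The functionals with sign vector `s`. -/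
def scell {n : ℕ} (z : Fin n → Euc d) (s : Fin n → SignType) : Set (Euc d) :=
  {c | ∀ i, SignType.sign ⟪z i, c⟫_ℝ = s i}

open Classical in
/-- Pointwise Gram relation. -/
lemma gram_pointwise {n : ℕ} (z : Fin n → Euc d) (W : Submodule ℝ (Euc d)) (v : Euc d) (hv : v ∉ W) :
    ∑ s : Fin n → SignType, (if ((scell z s) ∩ Wᗮ).Nonempty ∧
      ∀ c ∈ scell z s ∩ Wᗮ, ⟪v, c⟫_ℝ ≤ 0 then (-1 : ℝ) ^ Module.finrank ℝ (W ⊔ zspan z s : Submodule ℝ (Euc d))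
        else 0) = 0 := by
  have e1 := eps_sum W [] n z
  have e2 := eps_sum W [(v, 1)] n z
  have hcell : ∀ (s : Fin n → SignType) (l) (c), c ∈ cell W (List.ofFn (fun i => (z i, s i)) ++ l) ↔
      c ∈ scell z s ∩ Wᗮ ∧ ∀ p ∈ l, SignType.sign ⟪p.1, c⟫_ℝ = p.2 := by
    intro s l c
    simp only [cell, scell, Set.mem_ofPred_eq, List.mem_append, List.mem_ofFn, Set.mem_inter_iff, SetLike.mem_coe]
    constructor
    · rintro ⟨h1, h2⟩
      exact ⟨⟨fun i => h2 (z i, s i) (Or.inl ⟨i, rfl⟩), h1⟩, fun p hp => h2 p (Or.inr hp)⟩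
    · rintro ⟨⟨h1, h2⟩, h3⟩
      refine ⟨h2, ?_⟩
      rintro p (⟨i, rfl⟩ | hp)
      · exact h1 i
      · exact h3 p hp
  have hz : ∀ (s : Fin n → SignType) (l : List (Euc d × SignType)), (∀ p ∈ l, p.2 ≠ 0) →
      zsp W (List.ofFn (fun i => (z i, s i)) ++ l) = W ⊔ zspan z s := by
    intro s l hl
    rw [zsp, zspan]
    congr 2
    ext x
    simp only [Set.mem_ofPred_eq, List.mem_append, List.mem_ofFn, Set.mem_image, Prod.mk.injEq]
    constructor
    · rintro (⟨i, hi, hs⟩ | h)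
      · exact ⟨i, hs, hi⟩
      · exact absurd rfl (hl _ h)
    · rintro ⟨i, hs, hi⟩
      exact Or.inl ⟨i, hi, hs⟩
  have e3 : eps W [] = eps W [(v, 1)] := by
    have h1 : (cell W []).Nonempty := ⟨0, by simp [cell]⟩
    have h2 : (cell W [(v, 1)]).Nonempty := by
      by_contra hcon
      apply hv
      rw [← Submodule.orthogonal_orthogonal W, Submodule.mem_orthogonal']
      have key : ∀ u ∈ Wᗮ, ⟪v, u⟫_ℝ ≤ 0 := by
        intro u hu
        by_contra hlt
        refine hcon ⟨u, mem_cell_cons.2 ⟨⟨hu, by simp⟩, ?_⟩⟩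
        rw [sign_eq_one_iff]; simpa using hlt
      intro u hu
      apply le_antisymm (key u hu)
      have := key (-u) (Submodule.neg_mem _ hu)
      rw [inner_neg_right] at this
      linarith
    rw [eps, eps, if_pos h1, if_pos h2, zsp_cons_ne (by decide)]
  refine Eq.trans ?_ (sub_eq_zero.2 (e1.trans (e3.trans e2.symm)))
  rw [← Finset.sum_sub_distrib]
  refine Finset.sum_congr rfl fun s _ => ?_
  rw [eps, eps, hz s [] (by simp), hz s [(v, 1)] (by simp)]
  by_cases hA : ((scell z s) ∩ Wᗮ).Nonempty
  · rw [if_pos (show (cell W (List.ofFn (fun i => (z i, s i)) ++ [])).Nonempty from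
      hA.imp fun c hc => (hcell s [] c).2 ⟨hc, by simp⟩)]
    by_cases hB : ∀ c ∈ scell z s ∩ Wᗮ, ⟪v, c⟫_ℝ ≤ 0
    · rw [if_pos ⟨hA, hB⟩, if_neg, sub_zero]
      rintro ⟨c, hc⟩
      rw [hcell] at hc
      have := hc.2 (v, 1) (by simp)
      rw [sign_eq_one_iff] at this
      exact absurd (hB c hc.1) (not_le.2 this)
    · rw [if_neg (fun h => hB h.2), if_pos, sub_self]
      push Not at hB
      obtain ⟨c, hc, hlt⟩ := hB
      exact ⟨c, (hcell _ _ _).2 ⟨hc, by simpa [sign_eq_one_iff] using hlt⟩⟩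
  · rw [if_neg (fun h => hA h.1), if_neg, if_neg, sub_self]
    · rintro ⟨c, hc⟩; exact hA ⟨c, ((hcell _ _ _).1 hc).1⟩
    · rintro ⟨c, hc⟩; exact hA ⟨c, ((hcell _ _ _).1 hc).1⟩

end EulerPart

section ZonoPart
variable {d : ℕ}

/-- The zonotope with center `t` and generators `z`. -/
def zono {n : ℕ} (t : Euc d) (z : Fin n → Euc d) : Set (Euc d) :=
  {x | ∃ l : Fin n → ℝ, (∀ i, |l i| ≤ 1) ∧ x = t + ∑ i, l i • z i}

/-- The face of the zonotope attached to a sign vector. -/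
def zface {n : ℕ} (t : Euc d) (z : Fin n → Euc d) (s : Fin n → SignType) : Set (Euc d) :=
  {x | ∃ l : Fin n → ℝ, (∀ i, |l i| ≤ 1) ∧ (∀ i, s i ≠ 0 → l i = (s i : ℝ)) ∧
    x = t + ∑ i, l i • z i}

lemma sgn_cases (σ : SignType) : σ = 0 ∨ σ = 1 ∨ σ = -1 := by
  cases σ
  · exact Or.inl rfl
  · exact Or.inr (Or.inr rfl)
  · exact Or.inr (Or.inl rfl)

lemma abs_sgn_le (σ : SignType) : |(σ : ℝ)| ≤ 1 := by
  rcases sgn_cases σ with h | h | h <;> subst h <;> simp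

lemma sum_update_smul {n : ℕ} (z : Fin n → Euc d) (l : Fin n → ℝ) (i : Fin n) (a : ℝ) :
    ∑ j, Function.update l i a j • z j = ∑ j, l j • z j + (a - l i) • z i := by
  have : ∀ j, Function.update l i a j • z j = l j • z j + (if j = i then (a - l i) • z i else 0) := by
    intro j
    by_cases h : j = i
    · subst h; simp [sub_smul]
    · simp [h]
  simp [this, Finset.sum_add_distrib]

lemma abs_update_le {n : ℕ} (l : Fin n → ℝ) (hl : ∀ i, |l i| ≤ 1) (i : Fin n) (a : ℝ) (ha : |a| ≤ 1) :
    ∀ j, |Function.update l i a j| ≤ 1 := by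
  intro j
  by_cases h : j = i
  · subst h; simpa using ha
  · simpa [h] using hl j

lemma zface_subset {n : ℕ} (t : Euc d) (z : Fin n → Euc d) (s : Fin n → SignType) :
    zface t z s ⊆ zono t z := by
  rintro x ⟨l, hl, -, rfl⟩
  exact ⟨l, hl, rfl⟩

lemma zcenter_mem {n : ℕ} (t : Euc d) (z : Fin n → Euc d) (s : Fin n → SignType) :
    t + ∑ i, (s i : ℝ) • z i ∈ zface t z s :=
  ⟨fun i => (s i : ℝ), fun _ => abs_sgn_le _, fun _ _ => rfl, rfl⟩

lemma inner_zpt {n : ℕ} (t c : Euc d) (z : Fin n → Euc d) (l : Fin n → ℝ) :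
    ⟪c, t + ∑ i, l i • z i⟫_ℝ = ⟪c, t⟫_ℝ + ∑ i, l i * ⟪z i, c⟫_ℝ := by
  simp only [inner_add_right, inner_sum, inner_smul_right, real_inner_comm]

lemma zmax_iff {n : ℕ} (t : Euc d) (z : Fin n → Euc d) {s : Fin n → SignType} {c : Euc d}
    (hc : c ∈ scell z s) (l : Fin n → ℝ) (hl : ∀ i, |l i| ≤ 1) :
    (∀ y ∈ zono t z, ⟪c, y⟫_ℝ ≤ ⟪c, t + ∑ i, l i • z i⟫_ℝ) ↔ ∀ i, s i ≠ 0 → l i = (s i : ℝ) := by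
  have hle : ∀ (l : Fin n → ℝ), (∀ i, |l i| ≤ 1) → ∀ i, l i * ⟪z i, c⟫_ℝ ≤ (s i : ℝ) * ⟪z i, c⟫_ℝ := by
    intro l hl i
    rw [← hc i, sign_mul_self]
    calc l i * ⟪z i, c⟫_ℝ ≤ |l i * ⟪z i, c⟫_ℝ| := le_abs_self _
      _ = |l i| * |⟪z i, c⟫_ℝ| := abs_mul _ _
      _ ≤ 1 * |⟪z i, c⟫_ℝ| := mul_le_mul_of_nonneg_right (hl i) (abs_nonneg _)
      _ = _ := one_mul _
  constructor
  · intro h i hi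
    have h1 := h _ ⟨fun i => (s i : ℝ), fun _ => abs_sgn_le _, rfl⟩
    rw [inner_zpt, inner_zpt] at h1
    have h2 : ∑ i, l i * ⟪z i, c⟫_ℝ = ∑ i, (s i : ℝ) * ⟪z i, c⟫_ℝ :=
      le_antisymm (Finset.sum_le_sum fun i _ => hle l hl i) (by linarith)
    have h3 := (Finset.sum_eq_sum_iff_of_le (fun i _ => hle l hl i)).1 h2 i (Finset.mem_univ _)
    have h4 : ⟪z i, c⟫_ℝ ≠ 0 := by
      intro h0
      apply hi
      rw [← hc i, h0, sign_zero]
    exact mul_right_cancel₀ h4 h3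
  · rintro h y ⟨l', hl', rfl⟩
    rw [inner_zpt, inner_zpt]
    have : ∀ i, l' i * ⟪z i, c⟫_ℝ ≤ l i * ⟪z i, c⟫_ℝ := by
      intro i
      by_cases hi : s i = 0
      · have := hc i
        rw [hi, sign_eq_zero_iff] at this
        simp [this]
      · rw [h i hi]; exact hle l' hl' i
    have := Finset.sum_le_sum fun i (_ : i ∈ Finset.univ) => this i
    linarith

lemma zmax_eq {n : ℕ} (t : Euc d) (z : Fin n → Euc d) {s : Fin n → SignType} {c : Euc d}
    (hc : c ∈ scell z s) :
    {x ∈ zono t z | ∀ y ∈ zono t z, ⟪c, y⟫_ℝ ≤ ⟪c, x⟫_ℝ} = zface t z s := by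
  ext x
  constructor
  · rintro ⟨⟨l, hl, rfl⟩, hx⟩
    exact ⟨l, hl, (zmax_iff t z hc l hl).1 hx, rfl⟩
  · rintro ⟨l, hl, hs, rfl⟩
    exact ⟨⟨l, hl, rfl⟩, (zmax_iff t z hc l hl).2 hs⟩

lemma zface_inj {n : ℕ} (t : Euc d) (z : Fin n → Euc d) {s s' : Fin n → SignType}
    (hs : (scell z s).Nonempty) (hs' : (scell z s').Nonempty) (h : zface t z s = zface t z s') :
    s = s' := by
  have key : ∀ {s s' : Fin n → SignType}, (scell z s).Nonempty → zface t z s = zface t z s' →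
      ∀ i, s i ≠ 0 → s' i = s i := by
    rintro s s' ⟨c, hc⟩ h i hi
    have h1 := zcenter_mem t z s'
    rw [← h, ← zmax_eq t z hc] at h1
    have h2 := (zmax_iff t z hc (fun i => (s' i : ℝ)) (fun _ => abs_sgn_le _)).1 h1.2 i hi
    rcases sgn_cases (s i) with h | h | h <;> rcases sgn_cases (s' i) with h' | h' | h' <;>
      rw [h, h'] at h2 <;> rw [h, h'] <;> norm_num at h2
  funext i
  by_cases hi : s i = 0
  · by_cases hi' : s' i = 0
    · rw [hi, hi']
    · exact key hs' h.symm i hi'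
  · exact (key hs h i hi).symm

lemma isFace_iff {n : ℕ} (t : Euc d) (z : Fin n → Euc d) (F : Set (Euc d)) :
    (IsFace (zono t z) F ∧ F.Nonempty) ↔ ∃ s, (scell z s).Nonempty ∧ F = zface t z s := by
  constructor
  · rintro ⟨hF, hne⟩
    obtain ⟨l, hl⟩ := hF hne
    set c := (InnerProductSpace.toDual ℝ (Euc d)).symm l with hc
    have hlc : ∀ x, l x = ⟪c, x⟫_ℝ := fun x => (InnerProductSpace.toDual_symm_apply).symm
    have hcs : c ∈ scell z (fun i => SignType.sign ⟪z i, c⟫_ℝ) := fun i => rfl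
    refine ⟨_, ⟨c, hcs⟩, ?_⟩
    rw [hl, ← zmax_eq t z hcs]
    simp only [hlc]
  · rintro ⟨s, ⟨c, hc⟩, rfl⟩
    refine ⟨fun _ => ⟨InnerProductSpace.toDual ℝ (Euc d) c, ?_⟩, ⟨_, zcenter_mem t z s⟩⟩
    rw [← zmax_eq t z hc]
    rfl

lemma vectorSpan_zface {n : ℕ} (t : Euc d) (z : Fin n → Euc d) (s : Fin n → SignType) :
    vectorSpan ℝ (zface t z s) = zspan z s := by
  apply le_antisymm
  · rw [vectorSpan_def, Submodule.span_le]
    rintro _ ⟨_, ⟨l, hl, hs, rfl⟩, _, ⟨l', hl', hs', rfl⟩, rfl⟩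
    have : (t + ∑ i, l i • z i) -ᵥ (t + ∑ i, l' i • z i) = ∑ i, (l i - l' i) • z i := by
      simp [sub_smul, Finset.sum_sub_distrib]
    simp only [SetLike.mem_coe]
    rw [this]
    refine Submodule.sum_mem _ fun i _ => ?_
    by_cases hi : s i = 0
    · exact Submodule.smul_mem _ _ (Submodule.subset_span ⟨i, hi, rfl⟩)
    · rw [hs i hi, hs' i hi]; simp
  · rw [zspan, Submodule.span_le]
    rintro _ ⟨i, hi, rfl⟩
    have hi' : s i = 0 := hi
    have h1 : t + ∑ j, Function.update (fun j => (s j : ℝ)) i 1 j • z j ∈ zface t z s := by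
      refine ⟨_, abs_update_le _ (fun _ => abs_sgn_le _) i 1 (by simp), ?_, rfl⟩
      intro j hj
      have : j ≠ i := by rintro rfl; exact hj hi'
      simp [this]
    have h2 := vsub_mem_vectorSpan ℝ h1 (zcenter_mem t z s)
    rw [sum_update_smul] at h2
    simpa [hi'] using h2

lemma scell_orth {n : ℕ} {z : Fin n → Euc d} {s : Fin n → SignType} {c : Euc d}
    (hc : c ∈ scell z s) : c ∈ (zspan z s)ᗮ := by
  rw [Submodule.mem_orthogonal]
  intro u hu
  induction hu using Submodule.span_induction with
  | mem x hx =>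
    obtain ⟨i, hi, rfl⟩ := hx
    have := hc i
    rw [show s i = 0 from hi, sign_eq_zero_iff] at this
    exact this
  | zero => simp
  | add x y _ _ hx hy => rw [inner_add_left, hx, hy, add_zero]
  | smul a x _ hx => rw [real_inner_smul_left, hx, mul_zero]

lemma sgn_zero_iff {n : ℕ} {z : Fin n → Euc d} {s : Fin n → SignType} (hs : (scell z s).Nonempty)
    (i : Fin n) : s i = 0 ↔ z i ∈ zspan z s := by
  constructor
  · intro h
    exact Submodule.subset_span ⟨i, h, rfl⟩
  · intro h
    obtain ⟨c, hc⟩ := hs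
    rw [← hc i, Submodule.inner_right_of_mem_orthogonal h (scell_orth hc), sign_zero]

lemma zono_convex {n : ℕ} (t : Euc d) (z : Fin n → Euc d) : Convex ℝ (zono t z) := by
  rintro _ ⟨l, hl, rfl⟩ _ ⟨l', hl', rfl⟩ a b ha hb hab
  refine ⟨fun i => a * l i + b * l' i, fun i => ?_, ?_⟩
  · calc |a * l i + b * l' i| ≤ |a * l i| + |b * l' i| := abs_add_le _ _
      _ = a * |l i| + b * |l' i| := by rw [abs_mul, abs_mul, abs_of_nonneg ha, abs_of_nonneg hb]
      _ ≤ a * 1 + b * 1 := add_le_add (mul_le_mul_of_nonneg_left (hl i) ha)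
          (mul_le_mul_of_nonneg_left (hl' i) hb)
      _ = 1 := by linarith
  · simp only [smul_add, Finset.smul_sum, add_smul, Finset.sum_add_distrib, smul_smul]
    have : t = a • t + b • t := by rw [← add_smul, hab, one_smul]
    nth_rewrite 3 [this]
    abel

lemma zface_convex {n : ℕ} (t : Euc d) (z : Fin n → Euc d) {s : Fin n → SignType}
    (hs : (scell z s).Nonempty) : Convex ℝ (zface t z s) :=
  ((isFace_iff t z _).2 ⟨s, hs, rfl⟩).1.convex (zono_convex t z)

lemma relPt_mem {n : ℕ} (t : Euc d) (z : Fin n → Euc d) {s : Fin n → SignType}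
    (hs : (scell z s).Nonempty) : relPt (zface t z s) ∈ intrinsicInterior ℝ (zface t z s) := by
  have h : (intrinsicInterior ℝ (zface t z s)).Nonempty :=
    Set.Nonempty.intrinsicInterior (zface_convex t z hs) ⟨_, zcenter_mem t z s⟩
  rw [relPt, dif_pos h]
  exact h.some_mem

lemma relint_move {F : Set (Euc d)} {q u : Euc d} (hq : q ∈ intrinsicInterior ℝ F)
    (hu : u ∈ vectorSpan ℝ F) : ∃ ε : ℝ, 0 < ε ∧ q + ε • u ∈ F := by
  rw [mem_intrinsicInterior] at hq
  obtain ⟨⟨y, hy'⟩, hy, rfl⟩ := hq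
  have hmem : ∀ t : ℝ, y + t • u ∈ affineSpan ℝ F := by
    intro t
    have := AffineSubspace.vadd_mem_of_mem_direction
      (s := affineSpan ℝ F) (v := t • u) (by rw [direction_affineSpan]; exact Submodule.smul_mem _ _ hu) hy'
    rw [vadd_eq_add, add_comm] at this
    exact this
  let f : ℝ → affineSpan ℝ F := fun t => ⟨y + t • u, hmem t⟩
  have hf : Continuous f := by
    apply Continuous.subtype_mk
    fun_prop
  have hf0 : f 0 = ⟨y, hy'⟩ := by
    apply Subtype.ext; simp [f]
  have h1 : f ⁻¹' (interior ((↑) ⁻¹' F : Set (affineSpan ℝ F))) ∈ nhds (0 : ℝ) := by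
    apply hf.continuousAt.preimage_mem_nhds
    rw [hf0]
    exact isOpen_interior.mem_nhds hy
  have h2 : ∀ᶠ t in nhdsWithin (0 : ℝ) (Set.Ioi 0), f t ∈ interior ((↑) ⁻¹' F : Set (affineSpan ℝ F)) :=
    nhdsWithin_le_nhds h1
  obtain ⟨t, ht, ht0⟩ := (h2.and self_mem_nhdsWithin).exists
  have h3 := interior_subset ht
  exact ⟨t, ht0, h3⟩

/-- Generators of the tangent cone. -/
def tgen {n : ℕ} (z : Fin n → Euc d) (s : Fin n → SignType) : Fin n ⊕ Fin n → Euc d :=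
  Sum.elim (fun i => if s i = 0 then z i else -((s i : ℝ) • z i))
    (fun i => if s i = 0 then -z i else -((s i : ℝ) • z i))

/-- The cone on a convex set, translated to contain the origin, as a pointed cone. -/
def posCone (S : Set (Euc d)) (hS : Convex ℝ S) (h0 : (0 : Euc d) ∈ S) : PointedCone ℝ (Euc d) where
  carrier := posHull S
  add_mem' := by
    rintro _ _ ⟨a, p, hp, ha, rfl⟩ ⟨b, q, hq, hb, rfl⟩
    rcases eq_or_lt_of_le (add_nonneg ha hb) with h | h
    · have h1 : a = 0 := by linarith
      have h2 : b = 0 := by linarith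
      exact ⟨0, 0, h0, le_rfl, by simp [h1, h2]⟩
    · refine ⟨a + b, (a / (a + b)) • p + (b / (a + b)) • q, hS hp hq (by positivity) (by positivity)
        (by field_simp), h.le, ?_⟩
      rw [smul_add, smul_smul, smul_smul, mul_div_cancel₀ _ h.ne', mul_div_cancel₀ _ h.ne']
  zero_mem' := ⟨0, 0, h0, le_rfl, by simp⟩
  smul_mem' := by
    rintro ⟨r, hr⟩ _ ⟨a, p, hp, ha, rfl⟩
    refine ⟨r * a, p, hp, mul_nonneg hr ha, ?_⟩
    show r • (a • p) = _
    rw [smul_smul]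

lemma innerCone_eq_hull {n : ℕ} (t : Euc d) (z : Fin n → Euc d) {s : Fin n → SignType}
    (hs : (scell z s).Nonempty) (hdim : sdim (zono t z) = d) :
    innerCone (zface t z s) (zono t z) = (PointedCone.hull ℝ (Set.range (tgen z s)) : Set (Euc d)) := by
  have htop : vectorSpan ℝ (zono t z) = ⊤ := by
    apply Submodule.eq_top_of_finrank_eq
    rw [finrank_euclideanSpace_fin]
    exact hdim
  have hq := relPt_mem t z hs
  rw [innerCone, htop, Submodule.top_orthogonal_eq_bot]
  set q := relPt (zface t z s) with hqdef
  obtain ⟨l, hl, hls, hql⟩ := intrinsicInterior_subset hq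
  set K := PointedCone.hull ℝ (Set.range (tgen z s)) with hK
  have hgK : ∀ j, tgen z s j ∈ K := fun j => Submodule.subset_span ⟨j, rfl⟩
  have hbot : posHull ((fun x => x - q) '' zono t z) + ((⊥ : Submodule ℝ (Euc d)) : Set (Euc d))
      = posHull ((fun x => x - q) '' zono t z) := by
    simp
  rw [hbot]
  apply Set.Subset.antisymm
  · rintro _ ⟨c, _, ⟨_, ⟨l', hl', rfl⟩, rfl⟩, hc, rfl⟩
    apply PointedCone.smul_mem K hc
    have : (t + ∑ i, l' i • z i) - q = ∑ i, (l' i - l i) • z i := by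
      rw [hql]; simp [sub_smul, Finset.sum_sub_distrib]
    show (t + ∑ i, l' i • z i) - q ∈ K
    rw [this]
    refine Submodule.sum_mem _ fun i _ => ?_
    have g1 := hgK (Sum.inl i)
    have g2 := hgK (Sum.inr i)
    simp only [tgen, Sum.elim_inl, Sum.elim_inr] at g1 g2
    by_cases hi : s i = 0
    · rw [if_pos hi] at g1 g2
      rcases le_total 0 (l' i - l i) with h | h
      · exact PointedCone.smul_mem K h g1
      · have := PointedCone.smul_mem K (neg_nonneg.2 h) g2
        rwa [smul_neg, neg_smul, neg_neg] at this
    · rw [if_neg hi] at g1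
      have hli := hls i hi
      have h1 := abs_le.1 (hl' i)
      rcases sgn_cases (s i) with h | h | h
      · exact absurd h hi
      · rw [h] at g1 hli
        have := PointedCone.smul_mem K (show 0 ≤ -(l' i - l i) by rw [hli]; simp; linarith) g1
        simp only [SignType.coe_one, one_smul] at this
        rwa [smul_neg, neg_smul, neg_neg] at this
      · rw [h] at g1 hli
        have := PointedCone.smul_mem K (show 0 ≤ (l' i - l i) by rw [hli]; simp; linarith) g1
        simpa using this
  · have hconv : Convex ℝ ((fun x => x - q) '' zono t z) := by
      have := (zono_convex t z).translate (-q)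
      have hfun : (fun x => x - q) = fun x => -q + x := by funext x; abel
      rw [hfun]
      exact this
    have h0 : (0 : Euc d) ∈ (fun x => x - q) '' zono t z :=
      ⟨q, zface_subset t z s (intrinsicInterior_subset hq), by simp⟩
    have : K ≤ posCone _ hconv h0 := by
      rw [hK, PointedCone.hull, Submodule.span_le]
      have mv : ∀ u : Euc d, q + u ∈ zono t z → u ∈ posHull ((fun x => x - q) '' zono t z) :=
        fun u hu => ⟨1, u, ⟨_, hu, by simp⟩, by norm_num, by simp⟩
      have hz : ∀ i u, s i = 0 → u ∈ vectorSpan ℝ (zface t z s) →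
          u ∈ posHull ((fun x => x - q) '' zono t z) := by
        intro i u hi hu
        obtain ⟨ε, hε, hmem⟩ := relint_move hq hu
        refine ⟨ε⁻¹, ε • u, ⟨_, zface_subset t z s hmem, by simp⟩, by positivity, ?_⟩
        rw [smul_smul, inv_mul_cancel₀ hε.ne', one_smul]
      have hnz : ∀ i, s i ≠ 0 → -((s i : ℝ) • z i) ∈ posHull ((fun x => x - q) '' zono t z) := by
        intro i hi
        apply mv
        refine ⟨Function.update l i 0, abs_update_le l hl i 0 (by simp), ?_⟩
        rw [sum_update_smul, hql, hls i hi]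
        simp only [zero_sub, neg_smul]
        abel
      have hzm : ∀ i, s i = 0 → z i ∈ vectorSpan ℝ (zface t z s) := by
        intro i hi
        rw [vectorSpan_zface]
        exact (sgn_zero_iff hs i).1 hi
      rintro _ ⟨i | i, rfl⟩
      · simp only [tgen, Sum.elim_inl]
        split_ifs with hi
        · exact hz i _ hi (hzm i hi)
        · exact hnz i hi
      · simp only [tgen, Sum.elim_inr]
        split_ifs with hi
        · exact hz i _ hi (Submodule.neg_mem _ (hzm i hi))
        · exact hnz i hi
    exact this

lemma innerCone_poly {n : ℕ} (t : Euc d) (z : Fin n → Euc d) {s : Fin n → SignType}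
    (hs : (scell z s).Nonempty) (hdim : sdim (zono t z) = d) :
    IsPolyhedralCone (innerCone (zface t z s) (zono t z)) :=
  (poly_iff _).2 ⟨_, Set.finite_range _, innerCone_eq_hull t z hs hdim⟩

lemma mem_innerCone {n : ℕ} (t : Euc d) (z : Fin n → Euc d) {s : Fin n → SignType}
    (hs : (scell z s).Nonempty) (hdim : sdim (zono t z) = d) (v : Euc d) :
    v ∈ innerCone (zface t z s) (zono t z) ↔ ∀ c ∈ scell z s, ⟪v, c⟫_ℝ ≤ 0 := by
  constructor
  · intro hv c hc
    rw [innerCone_eq_hull t z hs hdim, SetLike.mem_coe, PointedCone.hull] at hv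
    induction hv using Submodule.span_induction with
    | mem x hx =>
      have h0 : ∀ i, s i = 0 → ⟪z i, c⟫_ℝ = 0 := by
        intro i hi
        have := hc i
        rwa [hi, sign_eq_zero_iff] at this
      have h1 : ∀ i, ⟪-((s i : ℝ) • z i), c⟫_ℝ ≤ 0 := by
        intro i
        rw [inner_neg_left, real_inner_smul_left, ← hc i, sign_mul_self]
        have := abs_nonneg ⟪z i, c⟫_ℝ
        linarith
      obtain ⟨i | i, rfl⟩ := hx
      · simp only [tgen, Sum.elim_inl]
        split_ifs with hi
        · exact (h0 i hi).le
        · exact h1 i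
      · simp only [tgen, Sum.elim_inr]
        split_ifs with hi
        · rw [inner_neg_left, h0 i hi]; simp
        · exact h1 i
    | zero => simp
    | add x y _ _ hx hy => rw [inner_add_left]; linarith
    | smul a x _ hx =>
      show ⟪(a : ℝ) • x, c⟫_ℝ ≤ 0
      rw [real_inner_smul_left]
      exact mul_nonpos_of_nonneg_of_nonpos a.2 hx
  · intro hv
    obtain ⟨A, hA⟩ := poly_hrep (innerCone_poly t z hs hdim)
    rw [hA]
    intro a ha
    have hgen : ∀ j, 0 ≤ ⟪a, tgen z s j⟫_ℝ := by
      intro j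
      have : tgen z s j ∈ hcone A := by
        rw [← hA, innerCone_eq_hull t z hs hdim]
        exact Submodule.subset_span ⟨j, rfl⟩
      exact this a ha
    obtain ⟨c0, hc0⟩ := hs
    have hcell : ∀ ε : ℝ, 0 < ε → -a + ε • c0 ∈ scell z s := by
      intro ε hε i
      have g1 := hgen (Sum.inl i)
      have g2 := hgen (Sum.inr i)
      have hci := hc0 i
      simp only [tgen, Sum.elim_inl, Sum.elim_inr] at g1 g2
      rw [inner_add_right, inner_neg_right, inner_smul_right]
      rw [real_inner_comm] at g1 g2
      rcases sgn_cases (s i) with h | h | h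
      · rw [if_pos h] at g1 g2
        rw [inner_neg_left] at g2
        rw [h, sign_eq_zero_iff] at hci ⊢
        rw [hci]; linarith
      · rw [if_neg (by rw [h]; decide)] at g1
        rw [h] at g1
        rw [h, sign_eq_one_iff] at hci ⊢
        simp only [SignType.coe_one, one_smul, inner_neg_left] at g1
        have := mul_pos hε hci
        linarith
      · rw [if_neg (by rw [h]; decide)] at g1
        rw [h] at g1
        rw [h, sign_eq_neg_one_iff] at hci ⊢
        simp only [SignType.coe_neg_one, neg_smul, one_smul, neg_neg] at g1
        have := mul_neg_of_pos_of_neg hε hci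
        linarith
    rw [real_inner_comm]
    by_contra hlt
    push Not at hlt
    have h1 : ∀ ε : ℝ, 0 < ε → -⟪v, a⟫_ℝ + ε * ⟪v, c0⟫_ℝ ≤ 0 := by
      intro ε hε
      have := hv _ (hcell ε hε)
      rwa [inner_add_right, inner_neg_right, inner_smul_right] at this
    have h2 := h1 (-⟪v, a⟫_ℝ / (2 * (|⟪v, c0⟫_ℝ| + 1))) (by
      apply div_pos (by linarith); positivity)
    have h3 : -(|⟪v, c0⟫_ℝ| + 1) ≤ ⟪v, c0⟫_ℝ := by
      have := neg_abs_le ⟪v, c0⟫_ℝ; linarith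
    have h4 : 0 < |⟪v, c0⟫_ℝ| + 1 := by positivity
    have h5 : -⟪v, a⟫_ℝ / (2 * (|⟪v, c0⟫_ℝ| + 1)) * (-(|⟪v, c0⟫_ℝ| + 1)) ≤
        -⟪v, a⟫_ℝ / (2 * (|⟪v, c0⟫_ℝ| + 1)) * ⟪v, c0⟫_ℝ :=
      mul_le_mul_of_nonneg_left h3 (div_nonneg (by linarith) (by positivity))
    have h6 : -⟪v, a⟫_ℝ / (2 * (|⟪v, c0⟫_ℝ| + 1)) * (-(|⟪v, c0⟫_ℝ| + 1)) = ⟪v, a⟫_ℝ / 2 := by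
      field_simp
    linarith

lemma mem_normalCone {n : ℕ} (t : Euc d) (z : Fin n → Euc d) (s : Fin n → SignType) (c : Euc d) :
    c ∈ normalCone (zface t z s) (zono t z) ↔
      c ∈ (zspan z s)ᗮ ∧ ∀ i, 0 ≤ (s i : ℝ) * ⟪z i, c⟫_ℝ := by
  constructor
  · intro h
    have hx := h _ (zcenter_mem t z s)
    have hy : ∀ i a, |a| ≤ 1 → (a - (s i : ℝ)) * ⟪z i, c⟫_ℝ ≤ 0 := by
      intro i a ha
      have := hx (t + ∑ j, Function.update (fun j => (s j : ℝ)) i a j • z j)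
        ⟨_, abs_update_le _ (fun _ => abs_sgn_le _) i a ha, rfl⟩
      rw [sum_update_smul, ← add_assoc, inner_add_right _ _ ((a - (s i : ℝ)) • z i),
        inner_smul_right, real_inner_comm (z i) c] at this
      linarith
    constructor
    · rw [Submodule.mem_orthogonal]
      intro u hu
      induction hu using Submodule.span_induction with
      | mem x hx =>
        obtain ⟨i, hi, rfl⟩ := hx
        have h1 := hy i 1 (by simp)
        have h2 := hy i (-1) (by simp)
        rw [show s i = 0 from hi] at h1 h2
        simp at h1 h2
        linarith
      | zero => simp
      | add x y _ _ hx hy => rw [inner_add_left, hx, hy, add_zero]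
      | smul a x _ hx => rw [real_inner_smul_left, hx, mul_zero]
    · intro i
      have := hy i 0 (by simp)
      linarith
  · rintro ⟨h1, h2⟩ _ ⟨l, hl, hs, rfl⟩ _ ⟨l', hl', rfl⟩
    rw [inner_zpt, inner_zpt]
    have : ∀ i, l' i * ⟪z i, c⟫_ℝ ≤ l i * ⟪z i, c⟫_ℝ := by
      intro i
      have ha := abs_le.1 (hl' i)
      have hi2 := h2 i
      rcases sgn_cases (s i) with h | h | h
      · have : ⟪z i, c⟫_ℝ = 0 :=
          Submodule.inner_right_of_mem_orthogonal (show z i ∈ zspan z s from Submodule.subset_span ⟨i, h, rfl⟩) h1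
        simp [this]
      · rw [hs i (by rw [h]; decide), h]
        rw [h] at hi2
        simp at hi2 ⊢
        nlinarith
      · rw [hs i (by rw [h]; decide), h]
        rw [h] at hi2
        simp at hi2 ⊢
        nlinarith
    have := Finset.sum_le_sum fun i (_ : i ∈ Finset.univ) => this i
    linarith

lemma mem_outerCone {n : ℕ} (t : Euc d) (z : Fin n → Euc d) (s : Fin n → SignType) (x : Euc d) :
    x ∈ outerCone (zface t z s) (zono t z) ↔
      ∀ i, 0 ≤ (s i : ℝ) * ⟪(zspan z s)ᗮ.starProjection (z i), x⟫_ℝ := by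
  rw [outerCone, vectorSpan_zface]
  simp only [Submodule.inner_starProjection_left_eq_right]
  constructor
  · rintro ⟨c, hc, w, hw, rfl⟩ i
    rw [mem_normalCone] at hc
    have h1 : (zspan z s)ᗮ.starProjection (c + w) = c := by
      rw [map_add, Submodule.starProjection_eq_self_iff.2 hc.1,
        (Submodule.starProjection_apply_eq_zero_iff _).2, add_zero]
      rwa [Submodule.orthogonal_orthogonal]
    show 0 ≤ (s i : ℝ) * ⟪z i, (zspan z s)ᗮ.starProjection (c + w)⟫_ℝ
    rw [h1]
    exact hc.2 i
  · intro h
    refine ⟨(zspan z s)ᗮ.starProjection x, ?_, x - (zspan z s)ᗮ.starProjection x, ?_, by simp⟩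
    · rw [mem_normalCone]
      exact ⟨Submodule.starProjection_apply_mem _ _, h⟩
    · have := Submodule.sub_starProjection_mem_orthogonal (K := (zspan z s)ᗮ) x
      rwa [Submodule.orthogonal_orthogonal] at this

lemma outerCone_poly {n : ℕ} (t : Euc d) (z : Fin n → Euc d) (s : Fin n → SignType) :
    IsPolyhedralCone (outerCone (zface t z s) (zono t z)) := by
  classical
  have := poly_hcone (Finset.univ.image fun i => (s i : ℝ) • (zspan z s)ᗮ.starProjection (z i))
  convert this using 1
  ext x
  rw [mem_outerCone]
  simp [hcone, real_inner_smul_left]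

end ZonoPart

section FiberPart
variable {d : ℕ}

open Classical in
/-- The covectors of the arrangement. -/
def covs {n : ℕ} (z : Fin n → Euc d) : Finset (Fin n → SignType) :=
  Finset.univ.filter fun s => (scell z s).Nonempty

lemma mem_covs {n : ℕ} {z : Fin n → Euc d} {s : Fin n → SignType} :
    s ∈ covs z ↔ (scell z s).Nonempty := by
  simp [covs]

open Classical in
lemma ext_fiber (α : ConeAngle d) {n : ℕ} (t : Euc d) (z : Fin n → Euc d) {s0 : Fin n → SignType}
    (h0 : s0 ∈ covs z) :
    ∑ s ∈ (covs z).filter (fun s => zspan z s = zspan z s0),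
      α.toFun (outerCone (zface t z s) (zono t z)) = 1 := by
  set L := zspan z s0 with hL
  have h0L : ∀ i, s0 i = 0 ↔ z i ∈ L := sgn_zero_iff (mem_covs.1 h0)
  have := alpha_sum α ((covs z).filter (fun s => zspan z s = L)) (fun _ => 1)
    (fun s => outerCone (zface t z s) (zono t z)) (fun s _ => outerCone_poly t z s)
    (Finset.univ.image fun i => Lᗮ.starProjection (z i)) 1 ?_
  · simpa using this
  intro v hv
  set σ : Fin n → SignType := fun i => SignType.sign ⟪z i, Lᗮ.starProjection v⟫_ℝ with hσ
  have hin : ∀ i, ⟪Lᗮ.starProjection (z i), v⟫_ℝ = ⟪z i, Lᗮ.starProjection v⟫_ℝ := fun i =>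
    Submodule.inner_starProjection_left_eq_right _ _ _
  have hz : ∀ i, σ i = 0 ↔ z i ∈ L := by
    intro i
    rw [hσ]
    show SignType.sign _ = 0 ↔ _
    rw [sign_eq_zero_iff]
    constructor
    · intro h
      by_contra hc
      refine hv (Lᗮ.starProjection (z i)) (by simp) ?_ (by rw [hin, h])
      intro h'
      rw [Submodule.starProjection_apply_eq_zero_iff, Submodule.orthogonal_orthogonal] at h'
      exact hc h'
    · intro h
      exact Submodule.inner_right_of_mem_orthogonal h (Submodule.starProjection_apply_mem _ _)
  have hσL : zspan z σ = L := by
    rw [hL, zspan, zspan]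
    congr 2
    ext i
    show σ i = 0 ↔ s0 i = 0
    rw [hz, h0L]
  have hσS : σ ∈ (covs z).filter (fun s => zspan z s = L) := by
    rw [Finset.mem_filter, mem_covs]
    exact ⟨⟨Lᗮ.starProjection v, fun i => rfl⟩, hσL⟩
  rw [Finset.sum_eq_single_of_mem σ hσS]
  · rw [if_pos, mul_one]
    rw [mem_outerCone, hσL]
    intro i
    rw [hin]
    show 0 ≤ ((SignType.sign _ : SignType) : ℝ) * _
    rw [sign_mul_self]
    positivity
  · intro s hs hne
    rw [if_neg, mul_zero]
    intro hmem
    apply hne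
    rw [Finset.mem_filter, mem_covs] at hs
    rw [mem_outerCone, hs.2] at hmem
    have hsL := sgn_zero_iff hs.1
    rw [hs.2] at hsL
    funext i
    have h1 := hmem i
    rw [hin] at h1
    rcases sgn_cases (s i) with h | h | h
    · rw [h, (hz i).2 ((hsL i).1 h)]
    · have h2 : ⟪z i, Lᗮ.starProjection v⟫_ℝ ≠ 0 := by
        intro h3
        have := (hsL i).2 ((hz i).1 (sign_eq_zero_iff.2 h3))
        rw [h] at this
        exact absurd this (by decide)
      rw [h] at h1 ⊢
      simp only [SignType.coe_one, one_mul] at h1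
      exact (sign_eq_one_iff.2 (lt_of_le_of_ne h1 h2.symm)).symm
    · have h2 : ⟪z i, Lᗮ.starProjection v⟫_ℝ ≠ 0 := by
        intro h3
        have := (hsL i).2 ((hz i).1 (sign_eq_zero_iff.2 h3))
        rw [h] at this
        exact absurd this (by decide)
      rw [h] at h1 ⊢
      simp only [SignType.coe_neg_one, neg_mul, one_mul, Left.nonneg_neg_iff] at h1
      exact (sign_eq_neg_one_iff.2 (lt_of_le_of_ne h1 h2)).symm

open Classical in
lemma int_fiber (α : ConeAngle d) {n : ℕ} (t : Euc d) (z : Fin n → Euc d)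
    (hdim : sdim (zono t z) = d) {L : Submodule ℝ (Euc d)} (hL : L ≠ ⊤)
    (s0 : Fin n → SignType) (hLs0 : L = zspan z s0) :
    ∑ s ∈ (covs z).filter (fun s => L ≤ zspan z s),
      (-1 : ℝ) ^ Module.finrank ℝ (zspan z s) *
        α.toFun (innerCone (zface t z s) (zono t z)) = 0 := by
  have hu : ∃ u ∈ Lᗮ, u ≠ 0 := by
    rw [← Submodule.ne_bot_iff]
    rwa [Ne, Submodule.orthogonal_eq_bot_iff]
  obtain ⟨u, huL, hu0⟩ := hu
  apply alpha_sum α ((covs z).filter (fun s => L ≤ zspan z s))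
    (fun s => (-1 : ℝ) ^ Module.finrank ℝ (zspan z s)) (fun s => innerCone (zface t z s) (zono t z))
    (fun s hs => innerCone_poly t z (mem_covs.1 (Finset.mem_filter.1 hs).1) hdim) {u} 0
  intro v hv
  have hvL : v ∉ L := fun h => hv u (by simp) hu0 (Submodule.inner_left_of_mem_orthogonal h huL)
  refine Eq.trans ?_ (gram_pointwise z L v hvL)
  rw [Finset.sum_filter, covs, Finset.sum_filter]
  apply Finset.sum_congr rfl
  intro s _
  by_cases hs : (scell z s).Nonempty
  · rw [if_pos hs]
    by_cases hLs : L ≤ zspan z s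
    · rw [if_pos hLs]
      have hsub : scell z s ∩ (Lᗮ : Submodule ℝ (Euc d)) = scell z s := by
        apply Set.inter_eq_left.2
        intro c hc
        exact Submodule.orthogonal_le hLs (scell_orth hc)
      rw [hsub, sup_eq_right.2 hLs, mem_innerCone t z hs hdim]
      simp [hs]
    · rw [if_neg hLs, if_neg]
      rintro ⟨⟨c, hc, hcL⟩, h2⟩
      apply hLs
      rw [hLs0, zspan, Submodule.span_le]
      rintro _ ⟨i, hi, rfl⟩
      refine Submodule.subset_span ⟨i, ?_, rfl⟩
      show s i = 0
      rw [← hc i, sign_eq_zero_iff]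
      refine Submodule.inner_right_of_mem_orthogonal ?_ hcL
      rw [hLs0]
      exact Submodule.subset_span ⟨i, hi, rfl⟩
  · rw [if_neg hs, if_neg]
    rintro ⟨h, -⟩
    exact hs (h.mono Set.inter_subset_left)

lemma int_top (α : ConeAngle d) {n : ℕ} (t : Euc d) (z : Fin n → Euc d)
    (hdim : sdim (zono t z) = d) {s : Fin n → SignType} (hs : (scell z s).Nonempty) 
    (htop : zspan z s = ⊤) : α.toFun (innerCone (zface t z s) (zono t z)) = 1 := by
  rw [← α.norm']
  congr 1
  rw [Set.eq_univ_iff_forall]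
  intro v
  rw [mem_innerCone t z hs hdim]
  intro c hc
  have := scell_orth hc
  rw [htop, Submodule.top_orthogonal_eq_bot, Submodule.mem_bot] at this
  simp [this]

lemma top_unique {n : ℕ} (z : Fin n → Euc d) {s : Fin n → SignType} (hs : (scell z s).Nonempty)
    (htop : zspan z s = ⊤) : s = 0 := by
  obtain ⟨c, hc⟩ := hs
  have := scell_orth hc
  rw [htop, Submodule.top_orthogonal_eq_bot, Submodule.mem_bot] at this
  funext i
  rw [← hc i, this]
  simp

end FiberPart

section MobPart

lemma chains_finite {β : Type*} [PartialOrder β] [Finite β] (a c : β) :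
    (chainsFromTo a c).Finite := by
  classical
  have := Fintype.ofFinite β
  have h : {l : List β | l.Nodup}.Finite := by
    have : Finite {l : List β // l.Nodup} := inferInstance
    exact this
  apply h.subset
  rintro l ⟨hl, -, -⟩
  exact (List.isChain_iff_pairwise.1 hl).imp (fun h => h.ne)

lemma mob_self {β : Type*} [PartialOrder β] (a : β) : mob a a = 1 := by
  have : chainsFromTo a a = {[a]} := by
    ext l
    constructor
    · rintro ⟨hl, h1, h2⟩
      rw [List.getLast?_eq_some_iff] at h2
      obtain ⟨l', rfl⟩ := h2
      rcases l' with _ | ⟨b, l'⟩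
      · rfl
      · simp at h1
        subst h1
        have := List.isChain_iff_pairwise.1 hl
        simp at this
        exact absurd (this.1 b (Or.inr rfl)) (lt_irrefl b)
    · rintro rfl
      exact ⟨List.isChain_singleton a, by simp, by simp⟩
  rw [mob, this, finsum_mem_singleton]
  norm_num

open Classical in
lemma mob_rec {β : Type*} [PartialOrder β] [Fintype β] (a c : β) (hac : a ≠ c) :
    mob a c = - ∑ b ∈ Finset.univ.filter (fun b => b < c), mob a b := by
  have hm : ∀ b, mob a b = ∑ l ∈ (chains_finite a b).toFinset, (-1 : ℝ) ^ (l.length + 1) := by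
    intro b
    rw [mob, finsum_mem_eq_finite_toFinset_sum]
  have hT : (chains_finite a c).toFinset =
      ((Finset.univ.filter (fun b => b < c)).biUnion
        fun b => (chains_finite a b).toFinset).image (fun l => l ++ [c]) := by
    ext l
    simp only [Set.Finite.mem_toFinset, Finset.mem_image, Finset.mem_biUnion, Finset.mem_filter,
      Finset.mem_univ, true_and]
    constructor
    · rintro ⟨hl, h1, h2⟩
      rw [List.getLast?_eq_some_iff] at h2
      obtain ⟨l', rfl⟩ := h2
      rcases List.eq_nil_or_concat l' with rfl | ⟨l'', b, rfl⟩
      · simp at h1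
        exact absurd h1.symm hac
      · have h3 := List.isChain_append.1 hl
        refine ⟨l''.concat b, ⟨b, h3.2.2 b (by simp) c (by simp), h3.1, ?_, by simp⟩, rfl⟩
        simpa using h1
    · rintro ⟨l', ⟨b, hb, hl, h1, h2⟩, rfl⟩
      refine ⟨List.isChain_append.2 ⟨hl, by simp, ?_⟩, ?_, by simp⟩
      · intro x hx y hy
        rw [h2] at hx
        simp at hx hy
        subst hx; subst hy
        exact hb
      · simp [h1]
  rw [hm, hT, Finset.sum_image, Finset.sum_biUnion, ← Finset.sum_neg_distrib]
  · apply Finset.sum_congr rfl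
    intro b _
    rw [hm, ← Finset.sum_neg_distrib]
    apply Finset.sum_congr rfl
    intro l _
    rw [List.length_append, pow_succ]
    simp
  · intro b _ b' _ hbb
    rw [Function.onFun, Finset.disjoint_left]
    intro l hl hl'
    simp only [Set.Finite.mem_toFinset] at hl hl'
    exact hbb (Option.some.inj (hl.2.2.symm.trans hl'.2.2))
  · intro l _ l' _ h
    simpa using h

end MobPart

section FinalPart
variable {d : ℕ}

lemma mem_Flats_zono {n : ℕ} (t : Euc d) (z : Fin n → Euc d) (L : Submodule ℝ (Euc d)) :
    L ∈ Flats (zono t z) ↔ ∃ s ∈ covs z, zspan z s = L := by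
  constructor
  · rintro ⟨F, hF, hne, rfl⟩
    obtain ⟨s, hs, rfl⟩ := (isFace_iff t z F).1 ⟨hF, hne⟩
    exact ⟨s, mem_covs.2 hs, (vectorSpan_zface t z s).symm⟩
  · rintro ⟨s, hs, rfl⟩
    have := (isFace_iff t z _).2 ⟨s, mem_covs.1 hs, rfl⟩
    exact ⟨_, this.1, this.2, (vectorSpan_zface t z s).symm⟩

lemma Flats_finite {n : ℕ} (t : Euc d) (z : Fin n → Euc d) : Finite ↥(Flats (zono t z)) := by
  classical
  have : Flats (zono t z) = ((covs z).image (zspan z) : Finset (Submodule ℝ (Euc d))) := by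
    ext L
    rw [mem_Flats_zono]
    simp
  rw [this]
  infer_instance

open Classical in
lemma fib_sum {n : ℕ} (t : Euc d) (z : Fin n → Euc d) [Fintype ↥(Flats (zono t z))]
    (g : (Fin n → SignType) → ℝ) (p : Submodule ℝ (Euc d) → Prop) [DecidablePred p] :
    ∑ s ∈ (covs z).filter (fun s => p (zspan z s)), g s =
      ∑ M : ↥(Flats (zono t z)),
        if p M.1 then ∑ s ∈ (covs z).filter (fun s => zspan z s = M.1), g s else 0 := by
  rw [← Finset.sum_subtype ((covs z).image (zspan z)) (p := fun L => L ∈ Flats (zono t z))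
    (by intro L; rw [mem_Flats_zono]; simp)
    (fun M => if p M then ∑ s ∈ (covs z).filter (fun s => zspan z s = M), g s else 0)]
  rw [Finset.sum_filter, ← Finset.sum_fiberwise_of_maps_to (s := covs z)
    (t := (covs z).image (zspan z)) (g := zspan z) (fun s hs => Finset.mem_image_of_mem _ hs)]
  apply Finset.sum_congr rfl
  intro M _
  split_ifs with h
  · apply Finset.sum_congr rfl
    intro s hs
    rw [(Finset.mem_filter.1 hs).2, if_pos h]
  · apply Finset.sum_eq_zero
    intro s hs
    rw [(Finset.mem_filter.1 hs).2, if_neg h]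

open Classical in
lemma face_sum {n : ℕ} (t : Euc d) (z : Fin n → Euc d) (i : ℕ) (g : Set (Euc d) → ℝ) :
    ∑ᶠ F ∈ {F : Set (Euc d) | IsFace (zono t z) F ∧ F.Nonempty ∧ sdim F = i}, g F =
      ∑ s ∈ (covs z).filter (fun s => Module.finrank ℝ (zspan z s) = i), g (zface t z s) := by
  have : {F : Set (Euc d) | IsFace (zono t z) F ∧ F.Nonempty ∧ sdim F = i} =
      zface t z '' ↑((covs z).filter (fun s => Module.finrank ℝ (zspan z s) = i)) := by
    ext F
    constructor
    · rintro ⟨hF, hne, hi⟩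
      obtain ⟨s, hs, rfl⟩ := (isFace_iff t z F).1 ⟨hF, hne⟩
      refine ⟨s, ?_, rfl⟩
      rw [Finset.mem_coe, Finset.mem_filter, mem_covs]
      rw [sdim, vectorSpan_zface] at hi
      exact ⟨hs, hi⟩
    · rintro ⟨s, hs, rfl⟩
      rw [Finset.mem_coe, Finset.mem_filter, mem_covs] at hs
      have := (isFace_iff t z _).2 ⟨s, hs.1, rfl⟩
      refine ⟨this.1, this.2, ?_⟩
      rw [sdim, vectorSpan_zface]
      exact hs.2
  rw [this, finsum_mem_image, finsum_mem_coe_finset]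
  intro s hs s' hs' h
  rw [Finset.mem_coe, Finset.mem_filter, mem_covs] at hs hs'
  exact zface_inj t z hs.1 hs'.1 h

open Classical in
lemma int_mob (α : ConeAngle d) {n : ℕ} (t : Euc d) (z : Fin n → Euc d)
    (hdim : sdim (zono t z) = d) [Fintype ↥(Flats (zono t z))] (top : ↥(Flats (zono t z)))
    (htop : top.1 = ⊤) (L : ↥(Flats (zono t z))) :
    ∑ s ∈ (covs z).filter (fun s => zspan z s = L.1),
      (-1 : ℝ) ^ Module.finrank ℝ (zspan z s) * α.toFun (innerCone (zface t z s) (zono t z)) =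
      (-1) ^ d * mob (OrderDual.toDual top) (OrderDual.toDual L) := by
  induction L using WellFoundedGT.induction with
  | ind L ih =>
  obtain ⟨s0, hs0, hs0L⟩ := (mem_Flats_zono t z L.1).1 L.2
  by_cases hL : L = top
  · subst hL
    rw [mob_self, mul_one, htop]
    rw [htop] at hs0L
    rw [Finset.sum_eq_single_of_mem s0 (by simp [hs0, hs0L])]
    · rw [hs0L, int_top α t z hdim (mem_covs.1 hs0) hs0L]
      simp
    · intro s hs hne
      rw [Finset.mem_filter] at hs
      exact absurd ((top_unique z (mem_covs.1 hs.1) hs.2).trans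
        (top_unique z (mem_covs.1 hs0) hs0L).symm) hne
  · have hLt : L.1 ≠ ⊤ := fun h => hL (Subtype.ext (h.trans htop.symm))
    have h1 := int_fiber α t z hdim hLt s0 hs0L.symm
    rw [fib_sum t z _ (fun M => L.1 ≤ M)] at h1
    have h2 := mob_rec (OrderDual.toDual top) (OrderDual.toDual L)
      (fun h => hL (OrderDual.toDual.injective h).symm)
    have h3 : ∑ b ∈ Finset.univ.filter (fun b => b < OrderDual.toDual L),
        mob (OrderDual.toDual top) b =
        ∑ M : ↥(Flats (zono t z)),
          if L < M then mob (OrderDual.toDual top) (OrderDual.toDual M) else 0 := by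
      rw [Finset.sum_filter]
      exact Fintype.sum_equiv OrderDual.ofDual _ _ (fun b => rfl)
    rw [h3] at h2
    rw [h2, mul_neg, Finset.mul_sum, eq_neg_iff_add_eq_zero]
    refine Eq.trans ?_ h1
    rw [← Finset.add_sum_erase Finset.univ _ (Finset.mem_univ L)]
    rw [← Finset.add_sum_erase Finset.univ (fun M : ↥(Flats (zono t z)) => if L.1 ≤ M.1 then _ else _)
      (Finset.mem_univ L)]
    rw [if_neg (lt_irrefl L), if_pos le_rfl, mul_zero, zero_add]
    congr 1
    apply Finset.sum_congr rfl
    intro M hM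
    have hne := (Finset.mem_erase.1 hM).1
    by_cases h : L.1 ≤ M.1
    · have hlt : L < M := lt_of_le_of_ne h hne.symm
      rw [if_pos hlt, if_pos h, ih M hlt]
    · rw [if_neg h, if_neg (fun h' : L < M => h h'.le), mul_zero]

lemma main_zono (α : ConeAngle d) {n : ℕ} (t : Euc d) (z : Fin n → Euc d)
    (hdim : sdim (zono t z) = d) (top : ↥(Flats (zono t z)))
    (htop : top.1 = vectorSpan ℝ (zono t z)) (i : ℕ) (hi : i < d) :
    extAngleSum α (zono t z) i =
      (Nat.card {L : ↥(Flats (zono t z)) // Module.finrank ℝ L.1 = i} : ℝ) ∧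
    intAngleSum α (zono t z) i = (-1) ^ (d - i) *
      whitney1 (β := (↥(Flats (zono t z)))ᵒᵈ)
        (fun L => d - Module.finrank ℝ (OrderDual.ofDual L).1)
        (OrderDual.toDual top) (d - i) := by
  classical
  have := Flats_finite t z
  have := Fintype.ofFinite ↥(Flats (zono t z))
  have htop' : top.1 = ⊤ := by
    rw [htop]
    apply Submodule.eq_top_of_finrank_eq
    rw [finrank_euclideanSpace_fin]
    exact hdim
  constructor
  · rw [extAngleSum, face_sum t z i (fun F => extAngle α F (zono t z)),
      fib_sum t z _ (fun M => Module.finrank ℝ M = i), Nat.card_eq_fintype_card,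
      Fintype.card_subtype, Finset.card_filter]
    push_cast
    apply Finset.sum_congr rfl
    intro M _
    obtain ⟨s0, hs0, hs0L⟩ := (mem_Flats_zono t z M.1).1 M.2
    rw [← hs0L]
    congr 1
    exact ext_fiber α t z hs0
  · rw [intAngleSum, face_sum t z i (fun F => intAngle α F (zono t z)),
      fib_sum t z _ (fun M => Module.finrank ℝ M = i), whitney1, finsum_mem_def,
      finsum_eq_sum_of_fintype, Fintype.sum_equiv OrderDual.ofDual _
      (fun M => if Module.finrank ℝ M.1 = i then mob (OrderDual.toDual top) (OrderDual.toDual M) else 0),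
      Finset.mul_sum]
    · apply Finset.sum_congr rfl
      intro M _
      split_ifs with h
      · have h1 := int_mob α t z hdim top htop' M
        have h2 : ∑ s ∈ (covs z).filter (fun s => zspan z s = M.1),
            (-1 : ℝ) ^ Module.finrank ℝ (zspan z s) *
              α.toFun (innerCone (zface t z s) (zono t z)) =
            (-1) ^ i * ∑ s ∈ (covs z).filter (fun s => zspan z s = M.1),
              intAngle α (zface t z s) (zono t z) := by
          rw [Finset.mul_sum]
          apply Finset.sum_congr rfl
          intro s hs
          rw [(Finset.mem_filter.1 hs).2, h, intAngle]
        rw [h2] at h1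
        have h3 : ((-1 : ℝ) ^ i) * (-1) ^ i = 1 := by
          rw [← mul_pow]; norm_num
        have h4 : (-1 : ℝ) ^ d = (-1) ^ i * (-1) ^ (d - i) := by
          rw [← pow_add, Nat.add_sub_cancel' hi.le]
        rw [h4, mul_assoc] at h1
        exact mul_left_cancel₀ (pow_ne_zero i (by norm_num)) h1
      · rw [mul_zero]
    · intro b
      rw [Set.indicator_apply]
      have hle : Module.finrank ℝ (OrderDual.ofDual b).1 ≤ d := by
        have := Submodule.finrank_le (OrderDual.ofDual b).1
        rwa [finrank_euclideanSpace_fin] at this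
      have hiff : b ∈ {a : (↥(Flats (zono t z)))ᵒᵈ |
          d - Module.finrank ℝ (OrderDual.ofDual a).1 = d - i} ↔
          Module.finrank ℝ (OrderDual.ofDual b).1 = i := by
        rw [Set.mem_ofPred_eq]
        omega
      simp only [hiff]
      rfl

end FinalPart

/-- Theorem 1.2.
For a `d`-dimensional zonotope `Z ⊂ ℝ^d` with lattice of flats `L(Z)` and any cone
angle `α`: `α̌_i(Z) = W_i(L(Z))` and `α̂_i(Z) = (-1)^{d-i} w_{d-i}(L(Z)^op)` for all
`i = 0, …, d-1`; in particular the angle vectors do not depend on the cone angle. -/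
theorem statement3 (d : ℕ) (hd : 0 < d) (α : ConeAngle d) (Z : Set (Euc d))
    (hZ : IsZonotope Z) (hdim : sdim Z = d)
    (top : ↥(Flats Z)) (htop : top.1 = vectorSpan ℝ Z)
    (i : ℕ) (hi : i < d) :
    extAngleSum α Z i =
      (Nat.card {L : ↥(Flats Z) // Module.finrank ℝ L.1 = i} : ℝ) ∧
    intAngleSum α Z i = (-1) ^ (d - i) *
      whitney1 (β := (↥(Flats Z))ᵒᵈ)
        (fun L => d - Module.finrank ℝ (OrderDual.ofDual L).1)
        (OrderDual.toDual top) (d - i) := by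
  obtain ⟨t, n, z, rfl⟩ := hZ
  exact main_zono α t z hdim top htop i hi


end GramAngles
end
end

section
/- Let P ⊂ ℝ^d be a belt polytope of dimension d with lattice of flats L(P), and let α be any cone angle on ℝ^d. Then α̌_i(P) = W_i(L(P)) for all i = 0, 1, …, d−1. -/
open scoped BigOperators InnerProductSpace Pointwise

noncomputable section

namespace GramAngles

/-- Finitely generated cone, via Mathlib's conical hull. -/
def FGC {d : ℕ} (C : Set (Euc d)) : Prop :=
  ∃ s : Set (Euc d), s.Finite ∧ C = (PointedCone.hull ℝ s : Set (Euc d))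

lemma hull_comb {d : ℕ} (s : Set (Euc d)) (f : Euc d →ₗ[ℝ] ℝ) (D : PointedCone ℝ (Euc d))
    (hB : ∀ v ∈ s, ∀ u ∈ s, 0 ≤ f v → f u ≤ 0 → f v • u - f u • v ∈ D) (a b : Euc d)
    (ha : a ∈ PointedCone.hull ℝ {v ∈ s | 0 ≤ f v})
    (hb : b ∈ PointedCone.hull ℝ {v ∈ s | f v ≤ 0}) :
    f a • b - f b • a ∈ D := by
  induction ha using Submodule.span_induction with
  | zero => simp
  | mem v hv =>
    induction hb using Submodule.span_induction with
    | zero => simp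
    | mem u hu => exact hB v hv.1 u hu.1 hv.2 hu.2
    | add x y _ _ hx hy =>
      have := D.add_mem hx hy
      convert this using 1
      simp only [map_add]; module
    | smul c x _ hx =>
      have := PointedCone.smul_mem D c.2 hx
      convert this using 1
      rw [show c • x = (c : ℝ) • x from rfl, map_smul, smul_eq_mul]; module
  | add x y _ _ hx hy =>
    have := D.add_mem hx hy
    convert this using 1
    simp only [map_add]; module
  | smul c x _ hx =>
    have := PointedCone.smul_mem D c.2 hx
    convert this using 1
    rw [show c • x = (c : ℝ) • x from rfl, map_smul, smul_eq_mul]; module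

lemma hull_nonneg {d : ℕ} (s : Set (Euc d)) (f : Euc d →ₗ[ℝ] ℝ) (hs : ∀ v ∈ s, 0 ≤ f v)
    (a : Euc d) (ha : a ∈ PointedCone.hull ℝ s) : 0 ≤ f a := by
  induction ha using Submodule.span_induction with
  | zero => simp
  | mem v hv => exact hs v hv
  | add x y _ _ hx hy => rw [map_add]; linarith
  | smul c x _ hx =>
    rw [show c • x = (c : ℝ) • x from rfl, map_smul, smul_eq_mul]
    exact mul_nonneg c.2 hx

lemma hull_zero {d : ℕ} (s : Set (Euc d)) (f : Euc d →ₗ[ℝ] ℝ) (D : PointedCone ℝ (Euc d))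
    (hA : ∀ v ∈ s, f v = 0 → v ∈ D) (b : Euc d)
    (hb : b ∈ PointedCone.hull ℝ {v ∈ s | f v ≤ 0}) : f b ≤ 0 ∧ (f b = 0 → b ∈ D) := by
  induction hb using Submodule.span_induction with
  | zero => simp
  | mem v hv => exact ⟨hv.2, hA v hv.1⟩
  | add x y _ _ hx hy =>
    rw [map_add]
    refine ⟨by linarith [hx.1, hy.1], fun h => D.add_mem (hx.2 ?_) (hy.2 ?_)⟩ <;>
      linarith [hx.1, hy.1]
  | smul c x _ hx =>
    rw [show c • x = (c : ℝ) • x from rfl, map_smul, smul_eq_mul]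
    refine ⟨mul_nonpos_of_nonneg_of_nonpos c.2 hx.1, fun h => ?_⟩
    rcases mul_eq_zero.1 h with h | h
    · rw [h, zero_smul]; exact D.zero_mem
    · exact PointedCone.smul_mem D c.2 (hx.2 h)

lemma FGC.inter_half {d : ℕ} {C : Set (Euc d)} (hC : FGC C) (w : Euc d) :
    FGC (C ∩ {x | 0 ≤ ⟪w, x⟫_ℝ}) := by
  obtain ⟨s, hs, rfl⟩ := hC
  set f : Euc d →ₗ[ℝ] ℝ := innerₗ (Euc d) w with hf
  have hfx : ∀ x, ⟪w, x⟫_ℝ = f x := fun x => rfl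
  set A := {v ∈ s | 0 ≤ f v}
  set N := {v ∈ s | f v ≤ 0}
  set B := (fun p : Euc d × Euc d => f p.1 • p.2 - f p.2 • p.1) '' (A ×ˢ N)
  have hAf : A.Finite := hs.subset (fun x hx => hx.1)
  have hNf : N.Finite := hs.subset (fun x hx => hx.1)
  refine ⟨A ∪ B, hAf.union ((hAf.prod hNf).image _), ?_⟩
  set D := PointedCone.hull ℝ (A ∪ B) with hD
  have hAD : A ⊆ D := fun x hx => Submodule.subset_span (Or.inl hx)
  have hBD : B ⊆ D := fun x hx => Submodule.subset_span (Or.inr hx)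
  ext x
  simp only [Set.mem_inter_iff, Set.mem_ofPred_eq, SetLike.mem_coe, hfx]
  constructor
  · rintro ⟨hx, h0⟩
    have hsu : s = A ∪ N := by
      ext v
      constructor
      · intro hv
        rcases le_total 0 (f v) with h | h
        · exact Or.inl ⟨hv, h⟩
        · exact Or.inr ⟨hv, h⟩
      · rintro (h | h) <;> exact h.1
    have hx' : x ∈ PointedCone.hull ℝ A ⊔ PointedCone.hull ℝ N := by
      rw [hsu] at hx
      rw [PointedCone.hull, PointedCone.hull, ← Submodule.span_union]
      exact hx
    obtain ⟨a, ha, b, hb, rfl⟩ := Submodule.mem_sup.1 hx'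
    have hfa : 0 ≤ f a := hull_nonneg A f (fun v hv => hv.2) a ha
    have haD : a ∈ D := (Submodule.span_le.2 hAD) ha
    obtain ⟨hb1, hb2⟩ := hull_zero s f D (fun v hv h => hAD ⟨hv, h.ge⟩) b hb
    rw [map_add] at h0
    rcases hfa.eq_or_lt with h | h
    · exact D.add_mem haD (hb2 (by linarith))
    · have hc := hull_comb s f D (fun v hv u hu h1 h2 =>
        hBD ⟨(v, u), ⟨⟨hv, h1⟩, ⟨hu, h2⟩⟩, rfl⟩) a b ha hb
      have h1 := PointedCone.smul_mem D (inv_nonneg.2 hfa) hc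
      have h2 := PointedCone.smul_mem D (r := (f a)⁻¹ * (f a + f b)) (by positivity) haD
      convert D.add_mem h1 h2 using 1
      have : (f a)⁻¹ * f a = 1 := inv_mul_cancel₀ h.ne'
      rw [mul_add, this, smul_sub, smul_smul, smul_smul, this]
      module
  · intro hx
    constructor
    · refine (Submodule.span_le.2 ?_) hx
      rintro v (hv | ⟨⟨v, u⟩, ⟨hv, hu⟩, rfl⟩)
      · exact Submodule.subset_span hv.1
      · have h1 := PointedCone.smul_mem (PointedCone.hull ℝ s) hv.2 (Submodule.subset_span hu.1)
        have h2 := PointedCone.smul_mem (PointedCone.hull ℝ s) (neg_nonneg.2 hu.2)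
          (Submodule.subset_span hv.1)
        have := Submodule.add_mem _ h1 h2
        rw [SetLike.mem_coe]
        convert this using 1
        simp only
        module
    · refine hull_nonneg (A ∪ B) f ?_ x hx
      rintro v (hv | ⟨⟨v, u⟩, ⟨hv, hu⟩, rfl⟩)
      · exact hv.2
      · simp only [map_sub, map_smul, smul_eq_mul]
        linarith [mul_comm (f v) (f u)]

lemma FGC.inter_half' {d : ℕ} {C : Set (Euc d)} (hC : FGC C) (w : Euc d) :
    FGC (C ∩ {x | ⟪w, x⟫_ℝ ≤ 0}) := by
  have := hC.inter_half (-w)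
  simpa [inner_neg_left] using this

lemma FGC.isPolyhedralCone {d : ℕ} {C : Set (Euc d)} (hC : FGC C) : IsPolyhedralCone C := by
  obtain ⟨s, hs, rfl⟩ := hC
  have := hs.fintype
  let e := (Fintype.equivFin s).symm
  refine ⟨Fintype.card s, fun i => (e i : Euc d), ?_⟩
  have hr : s = Set.range (fun i => (e i : Euc d)) := by
    ext x
    constructor
    · intro hx
      exact ⟨e.symm ⟨x, hx⟩, by simp⟩
    · rintro ⟨i, rfl⟩
      exact (e i).2
  ext x
  rw [SetLike.mem_coe]
  conv_lhs => rw [hr]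
  rw [PointedCone.hull, Submodule.mem_span_range_iff_exists_fun]
  constructor
  · rintro ⟨c, hc⟩
    exact ⟨fun i => c i, fun i => (c i).2, hc.symm⟩
  · rintro ⟨c, hc, h⟩
    exact ⟨fun i => ⟨c i, hc i⟩, h.symm⟩

lemma FGC.univ {d : ℕ} : FGC (Set.univ : Set (Euc d)) := by
  classical
  let b := (EuclideanSpace.basisFun (Fin d) ℝ)
  refine ⟨Set.range b ∪ Set.range (fun i => - b i),
    (Set.finite_range _).union (Set.finite_range _), ?_⟩
  symm
  rw [Set.eq_univ_iff_forall]
  intro x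
  rw [SetLike.mem_coe, ← b.sum_repr x]
  refine Submodule.sum_mem _ fun i _ => ?_
  rcases le_total 0 (b.repr x i) with h | h
  · exact PointedCone.smul_mem _ h (Submodule.subset_span (Or.inl ⟨i, rfl⟩))
  · have := PointedCone.smul_mem (PointedCone.hull ℝ (Set.range b ∪ Set.range (fun i => - b i)))
      (neg_nonneg.2 h) (Submodule.subset_span (Or.inr ⟨i, rfl⟩))
    simpa using this

/-- Closed chamber of an arrangement. -/
def cham {d k : ℕ} (w : Fin k → Euc d) (s t : Finset (Fin k)) : Set (Euc d) :=
  {x | ∀ i ∈ s, (i ∈ t → 0 ≤ ⟪w i, x⟫_ℝ) ∧ (i ∉ t → ⟪w i, x⟫_ℝ ≤ 0)}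

lemma cham_insert_mem {d k : ℕ} (w : Fin k → Euc d) (s t : Finset (Fin k)) (a : Fin k)
    (ha : a ∉ s) :
    cham w (insert a s) (insert a t) = cham w s t ∩ {x | 0 ≤ ⟪w a, x⟫_ℝ} := by
  ext x
  simp only [cham, Set.mem_ofPred_eq, Set.mem_inter_iff]
  rw [Finset.forall_mem_insert, and_comm]
  have h1 : (∀ i ∈ s, (i ∈ insert a t → 0 ≤ ⟪w i, x⟫_ℝ) ∧ (i ∉ insert a t → ⟪w i, x⟫_ℝ ≤ 0)) ↔
      (∀ i ∈ s, (i ∈ t → 0 ≤ ⟪w i, x⟫_ℝ) ∧ (i ∉ t → ⟪w i, x⟫_ℝ ≤ 0)) := by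
    refine forall₂_congr fun i hi => ?_
    have : i ≠ a := fun h => ha (h ▸ hi)
    simp [this]
  rw [h1]
  simp

lemma cham_insert_not_mem {d k : ℕ} (w : Fin k → Euc d) (s t : Finset (Fin k)) (a : Fin k)
    (ha : a ∉ t) :
    cham w (insert a s) t = cham w s t ∩ {x | ⟪w a, x⟫_ℝ ≤ 0} := by
  ext x
  simp only [cham, Set.mem_ofPred_eq, Set.mem_inter_iff, Finset.forall_mem_insert, ha]
  simp [and_comm]

lemma cham_FGC {d k : ℕ} (w : Fin k → Euc d) (s t : Finset (Fin k)) : FGC (cham w s t) := by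
  classical
  induction s using Finset.induction_on with
  | empty => simpa [cham] using FGC.univ
  | insert a s ha ih =>
    by_cases h : a ∈ t
    · rw [← Finset.insert_eq_of_mem h, cham_insert_mem w s t a ha]
      exact ih.inter_half _
    · rw [cham_insert_not_mem w s t a h]
      exact ih.inter_half' _

lemma sdim_lt_of_hyper {d : ℕ} (C : Set (Euc d)) (w : Euc d) (hw : w ≠ 0)
    (hC : ∀ x ∈ C, ⟪w, x⟫_ℝ = 0) : sdim C < d := by
  have h1 : vectorSpan ℝ C ≤ LinearMap.ker (innerₗ (Euc d) w) := by
    rw [vectorSpan_def, Submodule.span_le]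
    rintro _ ⟨x, hx, y, hy, rfl⟩
    simp [inner_sub_right, hC x hx, hC y hy]
  have h2 : vectorSpan ℝ C ≠ ⊤ := by
    intro h
    rw [h] at h1
    have := h1 (Submodule.mem_top (x := w))
    simp at this
    exact hw this
  have := Submodule.finrank_lt h2
  simpa [sdim] using this

lemma angle_split {d : ℕ} (α : ConeAngle d) {C : Set (Euc d)} (hC : FGC C) (w : Euc d)
    (hw : w ≠ 0) :
    α.toFun C = α.toFun (C ∩ {x | ⟪w, x⟫_ℝ ≤ 0}) + α.toFun (C ∩ {x | 0 ≤ ⟪w, x⟫_ℝ}) := by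
  have hu : (C ∩ {x | ⟪w, x⟫_ℝ ≤ 0}) ∪ (C ∩ {x | 0 ≤ ⟪w, x⟫_ℝ}) = C := by
    rw [← Set.inter_union_distrib_left]
    refine Set.inter_eq_left.2 fun x _ => ?_
    exact le_total ⟪w, x⟫_ℝ 0
  have hi : FGC ((C ∩ {x | ⟪w, x⟫_ℝ ≤ 0}) ∩ (C ∩ {x | 0 ≤ ⟪w, x⟫_ℝ})) := by
    have := (hC.inter_half' w).inter_half w
    convert this using 1
    ext x; simp; tauto
  have h := α.union' _ _ (hC.inter_half' w).isPolyhedralCone (hC.inter_half w).isPolyhedralCone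
    (by rw [hu]; exact hC.isPolyhedralCone) hi.isPolyhedralCone
  rw [hu, α.simple' _ hi.isPolyhedralCone, sub_zero] at h
  · exact h
  · exact sdim_lt_of_hyper _ w hw fun x hx => le_antisymm hx.1.2 hx.2.2

lemma sum_cham {d k : ℕ} (α : ConeAngle d) (w : Fin k → Euc d) (s : Finset (Fin k))
    (hw : ∀ i ∈ s, w i ≠ 0) : ∑ t ∈ s.powerset, α.toFun (cham w s t) = 1 := by
  classical
  induction s using Finset.induction_on with
  | empty => simpa [cham] using α.norm'
  | insert a s ha ih =>
    rw [Finset.sum_powerset_insert ha, ← Finset.sum_add_distrib,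
      ← ih (fun i hi => hw i (Finset.mem_insert_of_mem hi))]
    refine Finset.sum_congr rfl fun t ht => ?_
    rw [cham_insert_mem w s t a ha,
      cham_insert_not_mem w s t a (fun h => ha (Finset.mem_powerset.1 ht h))]
    exact (angle_split α (cham_FGC w s t) (w a) (hw a (Finset.mem_insert_self _ _))).symm

lemma inner_pos_of_interior {d : ℕ} (C : Set (Euc d)) (w x : Euc d) (hw : w ≠ 0)
    (hC : ∀ y ∈ C, 0 ≤ ⟪w, y⟫_ℝ) (hx : x ∈ interior C) : 0 < ⟪w, x⟫_ℝ := by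
  have hc : Filter.Tendsto (fun t : ℝ => x - t • w) (nhdsWithin 0 (Set.Ioi 0)) (nhds x) := by
    have : Continuous (fun t : ℝ => x - t • w) := by fun_prop
    have := this.tendsto 0
    simp only [zero_smul, sub_zero] at this
    exact this.mono_left nhdsWithin_le_nhds
  have h1 := hc.eventually (mem_interior_iff_mem_nhds.1 hx)
  obtain ⟨t, ht, ht0⟩ := (h1.and self_mem_nhdsWithin).exists
  have h2 := hC _ ht
  rw [inner_sub_right, inner_smul_right] at h2
  have h3 : 0 < ⟪w, w⟫_ℝ := real_inner_self_pos.2 hw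
  have : (0:ℝ) < t := ht0
  nlinarith [mul_pos this h3]

lemma cham_zero {d k : ℕ} (α : ConeAngle d) (w : Fin k → Euc d) (s t : Finset (Fin k))
    (hw : ∀ i ∈ s, w i ≠ 0)
    (h : ¬ ∃ x, ∀ i ∈ s, (i ∈ t → 0 < ⟪w i, x⟫_ℝ) ∧ (i ∉ t → ⟪w i, x⟫_ℝ < 0)) :
    α.toFun (cham w s t) = 0 := by
  refine α.simple' _ (cham_FGC w s t).isPolyhedralCone ?_
  by_contra hlt
  apply h
  have hconv : Convex ℝ (cham w s t) := by
    obtain ⟨S, _, hS⟩ := cham_FGC w s t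
    rw [hS]; exact PointedCone.convex _
  have h0 : (0 : Euc d) ∈ cham w s t := by simp [cham]
  have hsp : vectorSpan ℝ (cham w s t) = ⊤ := by
    by_contra hne
    have := Submodule.finrank_lt hne
    simp [sdim] at this hlt
    omega
  have hne : (interior (cham w s t)).Nonempty := by
    rw [hconv.interior_nonempty_iff_affineSpan_eq_top]
    exact (AffineSubspace.affineSpan_eq_top_iff_vectorSpan_eq_top_of_nonempty ℝ _ _ ⟨0, h0⟩).2 hsp
  obtain ⟨x, hx⟩ := hne
  refine ⟨x, fun i hi => ⟨fun hit => ?_, fun hit => ?_⟩⟩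
  · exact inner_pos_of_interior _ _ _ (hw i hi) (fun y hy => (hy i hi).1 hit) hx
  · have := inner_pos_of_interior _ (-w i) x (neg_ne_zero.2 (hw i hi))
      (fun y hy => by have := (hy i hi).2 hit; simpa [inner_neg_left] using this) hx
    simpa [inner_neg_left] using this

end GramAngles

namespace GramAngles

lemma sign_eq_iff' (a b : ℝ) :
    Real.sign a = Real.sign b ↔ ((0 < a ↔ 0 < b) ∧ (a < 0 ↔ b < 0)) := by
  rcases lt_trichotomy a 0 with ha | ha | ha <;> rcases lt_trichotomy b 0 with hb | hb | hb <;>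
    simp [Real.sign_of_neg, Real.sign_of_pos, ha, hb, ha.le, hb.le, not_lt.2] <;> norm_num

lemma maxFace_add {d : ℕ} (P : Set (Euc d)) (c0 c : Euc d) (hne : (maxFace P c0).Nonempty)
    (hc : c ∈ normalCone (maxFace P c0) P) (t : ℝ) (ht : 0 < t) :
    maxFace P (c + t • c0) = maxFace P c0 := by
  obtain ⟨y, hy⟩ := hne
  ext x
  constructor
  · rintro ⟨hxP, hx⟩
    refine ⟨hxP, fun v hv => ?_⟩
    have h1 := hx y hy.1
    simp only [inner_add_left, real_inner_smul_left] at h1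
    have h2 := hc y hy x hxP
    have h3 := hy.2 v hv
    have h4 : t * ⟪c0, y⟫_ℝ ≤ t * ⟪c0, x⟫_ℝ := by linarith
    have := le_of_mul_le_mul_left h4 ht
    linarith
  · intro hx
    refine ⟨hx.1, fun v hv => ?_⟩
    simp only [inner_add_left, real_inner_smul_left]
    have h1 := hc x hx v hv
    have h2 := mul_le_mul_of_nonneg_left (hx.2 v hv) ht.le
    linarith

lemma nc_iff {d k : ℕ} (P : Set (Euc d)) (z : Fin k → Euc d)
    (hz : ∀ c c' : Euc d,
      ((∀ i, Real.sign ⟪z i, c⟫_ℝ = Real.sign ⟪z i, c'⟫_ℝ) ↔ maxFace P c = maxFace P c'))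
    (c0 : Euc d) (hne : (maxFace P c0).Nonempty) (c : Euc d) :
    c ∈ normalCone (maxFace P c0) P ↔ ∀ i, (⟪z i, c0⟫_ℝ = 0 → ⟪z i, c⟫_ℝ = 0) ∧
      (0 < ⟪z i, c0⟫_ℝ → 0 ≤ ⟪z i, c⟫_ℝ) ∧ (⟪z i, c0⟫_ℝ < 0 → ⟪z i, c⟫_ℝ ≤ 0) := by
  constructor
  · intro hc i
    have key : ∀ t : ℝ, 0 < t → Real.sign (⟪z i, c⟫_ℝ + t * ⟪z i, c0⟫_ℝ) = Real.sign ⟪z i, c0⟫_ℝ := by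
      intro t ht
      have := (hz _ _).2 (maxFace_add P c0 c hne hc t ht) i
      rwa [inner_add_right, real_inner_smul_right] at this
    generalize ⟪z i, c⟫_ℝ = a at *
    generalize ⟪z i, c0⟫_ℝ = b at *
    refine ⟨fun h => ?_, fun h => ?_, fun h => ?_⟩
    · have := key 1 one_pos
      rw [sign_eq_iff', h] at this
      have h1 := this.1.not; have h2 := this.2.not
      simp at h1 h2
      linarith
    · by_contra ha
      push Not at ha
      have := (sign_eq_iff' _ _).1 (key (-a / b) (div_pos (by linarith) h))
      rw [div_mul_cancel₀ _ h.ne'] at this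
      have := this.1.2 h
      linarith
    · by_contra ha
      push Not at ha
      have := (sign_eq_iff' _ _).1 (key (-a / b) (div_pos_of_neg_of_neg (by linarith) h))
      rw [div_mul_cancel₀ _ h.ne] at this
      have := this.2.2 h
      linarith
  · intro hc x hx y hy
    have key : ∀ t : ℝ, 0 < t → maxFace P (c + t • c0) = maxFace P c0 := by
      intro t ht
      refine (hz _ _).1 fun i => ?_
      rw [inner_add_right, real_inner_smul_right, sign_eq_iff']
      obtain ⟨h1, h2, h3⟩ := hc i
      rcases lt_trichotomy ⟪z i, c0⟫_ℝ 0 with h | h | h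
      · have := h3 h
        have h5 := mul_neg_of_pos_of_neg ht h
        exact ⟨⟨fun _ => by linarith, fun _ => by linarith⟩,
          ⟨fun _ => by linarith, fun _ => by linarith⟩⟩
      · simp [h, h1 h]
      · have := h2 h
        have h5 := mul_pos ht h
        exact ⟨⟨fun _ => by linarith, fun _ => by linarith⟩,
          ⟨fun _ => by linarith, fun _ => by linarith⟩⟩
    have key2 : ∀ t : ℝ, 0 < t → ⟪c, y⟫_ℝ + t * ⟪c0, y⟫_ℝ ≤ ⟪c, x⟫_ℝ + t * ⟪c0, x⟫_ℝ := by
      intro t ht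
      rw [← key t ht] at hx
      have := hx.2 y hy
      simpa only [inner_add_left, real_inner_smul_left] using this
    have hle := hx.2 y hy
    refine le_of_forall_pos_le_add fun ε hε => ?_
    set D := ⟪c0, x⟫_ℝ - ⟪c0, y⟫_ℝ
    have hD : 0 ≤ D := sub_nonneg.2 hle
    have h1 := key2 (ε / (D + 1)) (by positivity)
    have h2 : ε / (D + 1) * D ≤ ε := by
      rw [div_mul_eq_mul_div, div_le_iff₀ (by positivity)]
      nlinarith
    have h3 : ε / (D + 1) * D = ε / (D + 1) * ⟪c0, x⟫_ℝ - ε / (D + 1) * ⟪c0, y⟫_ℝ := mul_sub _ _ _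
    linarith

lemma nc_orth {d : ℕ} (P F : Set (Euc d)) (hF : F ⊆ P) (c : Euc d) (hc : c ∈ normalCone F P) :
    c ∈ (vectorSpan ℝ F)ᗮ := by
  have h1 : vectorSpan ℝ F ≤ LinearMap.ker (innerₗ (Euc d) c) := by
    rw [vectorSpan_def, Submodule.span_le]
    rintro _ ⟨x, hx, y, hy, rfl⟩
    have h1 := hc x hx y (hF hy)
    have h2 := hc y hy x (hF hx)
    simp [inner_sub_right]
    linarith
  rw [Submodule.mem_orthogonal']
  intro u hu
  simpa using h1 hu

/-- Perturbing along a direction orthogonal to the face stays in the normal cone. -/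
lemma orth_pert {d : ℕ} (s : Finset (Euc d)) (c0 c : Euc d)
    (hne : (maxFace (convexHull ℝ (s : Set (Euc d))) c0).Nonempty)
    (hc : c ∈ (vectorSpan ℝ (maxFace (convexHull ℝ (s : Set (Euc d))) c0))ᗮ) :
    ∃ ε : ℝ, 0 < ε ∧ c0 + ε • c ∈ normalCone (maxFace (convexHull ℝ (s : Set (Euc d))) c0)
      (convexHull ℝ (s : Set (Euc d))) := by
  set P := convexHull ℝ (s : Set (Euc d)) with hP
  have hconst : ∀ x ∈ maxFace P c0, ∀ y ∈ maxFace P c0, ⟪c, x⟫_ℝ = ⟪c, y⟫_ℝ := by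
    intro x hx y hy
    rw [Submodule.mem_orthogonal'] at hc
    have := hc (x - y) (vsub_mem_vectorSpan ℝ hx hy)
    rw [inner_sub_right] at this
    linarith
  obtain ⟨q, hq⟩ := hne
  have hev : ∀ᶠ ε in nhdsWithin (0:ℝ) (Set.Ioi 0), ∀ v ∈ s,
      ⟪c0 + ε • c, v⟫_ℝ ≤ ⟪c0 + ε • c, q⟫_ℝ := by
    rw [Filter.eventually_all_finset]
    intro v hv
    have hvP : v ∈ P := subset_convexHull ℝ _ hv
    by_cases hvF : v ∈ maxFace P c0
    · refine Filter.Eventually.of_forall fun ε => ?_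
      rw [inner_add_left, inner_add_left, real_inner_smul_left, real_inner_smul_left,
        hconst v hvF q hq]
      have := hq.2 v hvP
      linarith
    · have hlt : ⟪c0, v⟫_ℝ < ⟪c0, q⟫_ℝ := by
        by_contra hcon
        push Not at hcon
        exact hvF ⟨hvP, fun y hy => (hq.2 y hy).trans hcon⟩
      have hcont : Filter.Tendsto (fun ε : ℝ => ⟪c0 + ε • c, q⟫_ℝ - ⟪c0 + ε • c, v⟫_ℝ)
          (nhds 0) (nhds (⟪c0, q⟫_ℝ - ⟪c0, v⟫_ℝ)) := by
        have : Continuous (fun ε : ℝ => ⟪c0 + ε • c, q⟫_ℝ - ⟪c0 + ε • c, v⟫_ℝ) := by fun_prop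
        have := this.tendsto 0
        simpa using this
      have := (hcont.mono_left (nhdsWithin_le_nhds (s := Set.Ioi 0))).eventually
        (lt_mem_nhds (sub_pos.2 hlt))
      filter_upwards [this] with ε h
      linarith
  obtain ⟨ε, h1, h2⟩ := (hev.and self_mem_nhdsWithin).exists
  refine ⟨ε, h2, fun x hx y hy => ?_⟩
  have hqx : ⟪c0 + ε • c, q⟫_ℝ = ⟪c0 + ε • c, x⟫_ℝ := by
    rw [inner_add_left, inner_add_left, real_inner_smul_left, real_inner_smul_left,
        hconst x hx q hq, le_antisymm (hq.2 x hx.1) (hx.2 q hq.1)]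
  rw [← hqx]
  have hconv : Convex ℝ {y : Euc d | ⟪c0 + ε • c, y⟫_ℝ ≤ ⟪c0 + ε • c, q⟫_ℝ} :=
    convex_halfSpace_le (innerₗ (Euc d) (c0 + ε • c)).isLinear _
  exact convexHull_min h1 hconv hy

lemma orth_iff {d k : ℕ} (s : Finset (Euc d)) (z : Fin k → Euc d) (P : Set (Euc d))
    (hP : P = convexHull ℝ (s : Set (Euc d)))
    (hz : ∀ c c' : Euc d,
      ((∀ i, Real.sign ⟪z i, c⟫_ℝ = Real.sign ⟪z i, c'⟫_ℝ) ↔ maxFace P c = maxFace P c'))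
    (c0 : Euc d) (hne : (maxFace P c0).Nonempty) (c : Euc d) :
    c ∈ (vectorSpan ℝ (maxFace P c0))ᗮ ↔ ∀ i, ⟪z i, c0⟫_ℝ = 0 → ⟪z i, c⟫_ℝ = 0 := by
  have hsub : maxFace P c0 ⊆ P := fun x hx => hx.1
  constructor
  · intro hc i hi
    subst hP
    obtain ⟨ε, hε, h⟩ := orth_pert s c0 c hne hc
    have := ((nc_iff _ z hz c0 hne _).1 h i).1 hi
    rw [inner_add_right, real_inner_smul_right, hi, zero_add] at this
    exact (mul_eq_zero.1 this).resolve_left hε.ne'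
  · intro hc
    have hev : ∀ᶠ ε in nhdsWithin (0:ℝ) (Set.Ioi 0), ∀ i,
        (⟪z i, c0⟫_ℝ = 0 → ⟪z i, c0 + ε • c⟫_ℝ = 0) ∧
        (0 < ⟪z i, c0⟫_ℝ → 0 ≤ ⟪z i, c0 + ε • c⟫_ℝ) ∧
        (⟪z i, c0⟫_ℝ < 0 → ⟪z i, c0 + ε • c⟫_ℝ ≤ 0) := by
      rw [Filter.eventually_all]
      intro i
      have hcont : Filter.Tendsto (fun ε : ℝ => ⟪z i, c0 + ε • c⟫_ℝ)
          (nhdsWithin (0:ℝ) (Set.Ioi 0)) (nhds ⟪z i, c0⟫_ℝ) := by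
        have : Continuous (fun ε : ℝ => ⟪z i, c0 + ε • c⟫_ℝ) := by fun_prop
        have := this.tendsto 0
        simp only [zero_smul, add_zero] at this
        exact this.mono_left nhdsWithin_le_nhds
      rcases lt_trichotomy ⟪z i, c0⟫_ℝ 0 with h | h | h
      · filter_upwards [hcont.eventually (gt_mem_nhds h)] with ε hε
        exact ⟨fun h' => absurd h' h.ne, fun h' => absurd h' h.le.not_gt, fun _ => hε.le⟩
      · refine Filter.Eventually.of_forall fun ε => ?_
        rw [inner_add_right, real_inner_smul_right, h, hc i h]
        simp
      · filter_upwards [hcont.eventually (lt_mem_nhds h)] with ε hε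
        exact ⟨fun h' => absurd h' h.ne', fun _ => hε.le, fun h' => absurd h' h.le.not_gt⟩
    obtain ⟨ε, h1, h2⟩ := (hev.and self_mem_nhdsWithin).exists
    have h3 := nc_orth P _ hsub _ ((nc_iff P z hz c0 hne _).2 h1)
    have h4 := nc_orth P _ hsub c0 (fun x hx y hy => hx.2 y hy)
    have h5 : ε • c ∈ (vectorSpan ℝ (maxFace P c0))ᗮ := by
      have := Submodule.sub_mem _ h3 h4
      simpa using this
    have h2' : ε ≠ 0 := ne_of_gt h2
    exact (Submodule.smul_mem_iff _ h2').1 h5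

lemma mem_flat_iff {d k : ℕ} (s : Finset (Euc d)) (z : Fin k → Euc d) (P : Set (Euc d))
    (hP : P = convexHull ℝ (s : Set (Euc d)))
    (hz : ∀ c c' : Euc d,
      ((∀ i, Real.sign ⟪z i, c⟫_ℝ = Real.sign ⟪z i, c'⟫_ℝ) ↔ maxFace P c = maxFace P c'))
    (c0 : Euc d) (hne : (maxFace P c0).Nonempty) (i : Fin k) :
    z i ∈ vectorSpan ℝ (maxFace P c0) ↔ ⟪z i, c0⟫_ℝ = 0 := by
  have ho := orth_iff s z P hP hz c0 hne
  constructor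
  · intro h
    exact Submodule.inner_right_of_mem_orthogonal h ((ho c0).2 fun _ h => h)
  · intro h
    rw [← Submodule.orthogonal_orthogonal (vectorSpan ℝ (maxFace P c0)),
      Submodule.mem_orthogonal']
    intro u hu
    exact (ho u).1 hu i h

lemma flat_eq {d k : ℕ} (s : Finset (Euc d)) (z : Fin k → Euc d) (P : Set (Euc d))
    (hP : P = convexHull ℝ (s : Set (Euc d)))
    (hz : ∀ c c' : Euc d,
      ((∀ i, Real.sign ⟪z i, c⟫_ℝ = Real.sign ⟪z i, c'⟫_ℝ) ↔ maxFace P c = maxFace P c'))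
    (c0 c1 : Euc d) (hne : (maxFace P c0).Nonempty) (hne1 : (maxFace P c1).Nonempty)
    (h : ∀ i, ⟪z i, c0⟫_ℝ = 0 ↔ ⟪z i, c1⟫_ℝ = 0) :
    vectorSpan ℝ (maxFace P c0) = vectorSpan ℝ (maxFace P c1) := by
  rw [← Submodule.orthogonal_orthogonal (vectorSpan ℝ (maxFace P c0)),
    ← Submodule.orthogonal_orthogonal (vectorSpan ℝ (maxFace P c1))]
  congr 1
  ext c
  rw [orth_iff s z P hP hz c0 hne, orth_iff s z P hP hz c1 hne1]
  simp only [h]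

lemma outer_eq {d k : ℕ} (s : Finset (Euc d)) (z : Fin k → Euc d) (P : Set (Euc d))
    (hP : P = convexHull ℝ (s : Set (Euc d)))
    (hz : ∀ c c' : Euc d,
      ((∀ i, Real.sign ⟪z i, c⟫_ℝ = Real.sign ⟪z i, c'⟫_ℝ) ↔ maxFace P c = maxFace P c'))
    (c0 : Euc d) (hne : (maxFace P c0).Nonempty) (L : Submodule ℝ (Euc d))
    (hL : vectorSpan ℝ (maxFace P c0) = L) (I t : Finset (Fin k))
    (hI : ∀ i, i ∈ I ↔ z i ∉ L) (ht : ∀ i, i ∈ t ↔ (i ∈ I ∧ 0 < ⟪z i, c0⟫_ℝ)) :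
    outerCone (maxFace P c0) P = cham (fun i => Lᗮ.starProjection (z i)) I t := by
  have hsub : maxFace P c0 ⊆ P := fun x hx => hx.1
  have hI' : ∀ i, i ∈ I ↔ ⟪z i, c0⟫_ℝ ≠ 0 := fun i => by
    rw [hI, ← hL, mem_flat_iff s z P hP hz c0 hne]
  have hnc := nc_iff P z hz c0 hne
  have hin : ∀ i x, ⟪Lᗮ.starProjection (z i), x⟫_ℝ = ⟪z i, Lᗮ.starProjection x⟫_ℝ :=
    fun i x => Submodule.inner_starProjection_left_eq_right _ _ _
  have hc0 := (orth_iff s z P hP hz c0 hne c0).2 fun _ h => h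
  have hmem : ∀ n ∈ Lᗮ, n ∈ normalCone (maxFace P c0) P ↔
      ∀ i ∈ I, (i ∈ t → 0 ≤ ⟪z i, n⟫_ℝ) ∧ (i ∉ t → ⟪z i, n⟫_ℝ ≤ 0) := by
    intro n hn
    rw [← hL, orth_iff s z P hP hz c0 hne] at hn
    rw [hnc]
    constructor
    · intro h i hi
      obtain ⟨_, h2, h3⟩ := h i
      rw [ht]
      refine ⟨fun h => h2 h.2, fun h => h3 ?_⟩
      have := (hI' i).1 hi
      rcases lt_trichotomy ⟪z i, c0⟫_ℝ 0 with h' | h' | h'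
      · exact h'
      · exact absurd h' this
      · exact absurd ⟨hi, h'⟩ h
    · intro h i
      refine ⟨hn i, fun hp => ?_, fun hp => ?_⟩
      · have hi := (hI' i).2 hp.ne'
        exact (h i hi).1 ((ht i).2 ⟨hi, hp⟩)
      · have hi := (hI' i).2 hp.ne
        exact (h i hi).2 (fun h' => absurd ((ht i).1 h').2 hp.le.not_gt)
  ext x
  rw [outerCone, hL]
  have hx : x ∈ cham (fun i => Lᗮ.starProjection (z i)) I t ↔
      Lᗮ.starProjection x ∈ normalCone (maxFace P c0) P := by
    rw [hmem _ (Submodule.starProjection_apply_mem _ _)]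
    simp only [cham, Set.mem_ofPred_eq, hin]
  rw [hx]
  constructor
  · rintro ⟨n, hn, l, hl, rfl⟩
    have h1 : n ∈ Lᗮ := hL ▸ nc_orth P _ hsub n hn
    have h2 : Lᗮ.starProjection (n + l) = n := by
      rw [map_add, Submodule.starProjection_eq_self_iff.2 h1,
        (Submodule.starProjection_apply_eq_zero_iff _).2 (by
          rw [Submodule.orthogonal_orthogonal]; exact hl), add_zero]
    simp only [h2]
    exact hn
  · intro h
    refine ⟨_, h, x - Lᗮ.starProjection x, ?_, by simp⟩
    have := Submodule.sub_starProjection_mem_orthogonal (K := Lᗮ) x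
    rwa [Submodule.orthogonal_orthogonal] at this

end GramAngles

namespace GramAngles

lemma maxFace_isFace {d : ℕ} (P : Set (Euc d)) (c : Euc d) : IsFace P (maxFace P c) := by
  intro _
  exact ⟨innerSL ℝ c, by simp [maxFace]⟩

lemma exists_maxFace {d : ℕ} (P F : Set (Euc d)) (hF : IsFace P F) (hne : F.Nonempty) :
    ∃ c, maxFace P c = F := by
  obtain ⟨l, hl⟩ := hF hne
  refine ⟨(InnerProductSpace.toDual ℝ (Euc d)).symm l, ?_⟩
  rw [hl, maxFace]
  simp only [InnerProductSpace.toDual_symm_apply]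

lemma maxFace_nonempty {d : ℕ} (P : Set (Euc d)) (hP : IsPolytope P) (c : Euc d) :
    (maxFace P c).Nonempty := by
  obtain ⟨s, hs, rfl⟩ := hP
  have hc : IsCompact (convexHull ℝ (s : Set (Euc d))) := s.finite_toSet.isCompact_convexHull ℝ
  have hn : (convexHull ℝ (s : Set (Euc d))).Nonempty := by
    rw [convexHull_nonempty_iff]; exact hs
  obtain ⟨x, hx, h⟩ := hc.exists_isMaxOn hn (f := fun y => ⟪c, y⟫_ℝ) (by fun_prop)
  exact ⟨x, hx, fun y hy => h hy⟩

lemma fiber_sum {d k : ℕ} (α : ConeAngle d) (P : Set (Euc d)) (hPp : IsPolytope P)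
    (z : Fin k → Euc d)
    (hz : ∀ c c' : Euc d,
      ((∀ i, Real.sign ⟪z i, c⟫_ℝ = Real.sign ⟪z i, c'⟫_ℝ) ↔ maxFace P c = maxFace P c'))
    (L : Submodule ℝ (Euc d)) (hL : L ∈ Flats P) (T : Finset (Set (Euc d)))
    (hT : ∀ F, F ∈ T ↔ (IsFace P F ∧ F.Nonempty ∧ vectorSpan ℝ F = L)) :
    ∑ F ∈ T, extAngle α F P = 1 := by
  classical
  obtain ⟨s, hs, hP⟩ := id hPp
  have hne := maxFace_nonempty P hPp
  have hC : ∀ F, ∃ c, F ∈ T → maxFace P c = F := by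
    intro F
    by_cases h : F ∈ T
    · obtain ⟨c, hc⟩ := exists_maxFace P F ((hT F).1 h).1 ((hT F).1 h).2.1
      exact ⟨c, fun _ => hc⟩
    · exact ⟨0, fun h' => absurd h' h⟩
  choose C hC using hC
  set I : Finset (Fin k) := Finset.univ.filter fun i => z i ∉ L with hIdef
  have hI : ∀ i, i ∈ I ↔ z i ∉ L := by simp [hIdef]
  set w : Fin k → Euc d := fun i => Lᗮ.starProjection (z i) with hw
  have hw0 : ∀ i ∈ I, w i ≠ 0 := by
    intro i hi h
    rw [hw, Submodule.starProjection_apply_eq_zero_iff, Submodule.orthogonal_orthogonal] at h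
    exact (hI i).1 hi h
  have hzero : ∀ c, vectorSpan ℝ (maxFace P c) = L → ∀ i, ⟪z i, c⟫_ℝ = 0 ↔ z i ∈ L := by
    intro c hc i
    rw [← hc, mem_flat_iff s z P hP hz c (hne c)]
  rw [← sum_cham α w I hw0]
  have hCL : ∀ F ∈ T, vectorSpan ℝ (maxFace P (C F)) = L := fun F hF => by
    rw [hC F hF]; exact ((hT F).1 hF).2.2
  have hinj : ∀ c c', vectorSpan ℝ (maxFace P c) = L → vectorSpan ℝ (maxFace P c') = L →
      (∀ i ∈ I, 0 < ⟪z i, c⟫_ℝ ↔ 0 < ⟪z i, c'⟫_ℝ) → maxFace P c = maxFace P c' := by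
    intro c c' h h' hh
    refine (hz _ _).1 fun i => ?_
    by_cases hi : z i ∈ L
    · rw [(hzero c h i).2 hi, (hzero c' h' i).2 hi]
    · have h1 := (hzero c h i).not.2 hi
      have h2 := (hzero c' h' i).not.2 hi
      have h3 := hh i ((hI i).2 hi)
      rw [sign_eq_iff']
      refine ⟨h3, ?_⟩
      rw [← not_iff_not, not_lt, not_lt, le_iff_lt_or_eq, le_iff_lt_or_eq, h3]
      simp [Ne.symm h1, Ne.symm h2]
  refine Finset.sum_of_injOn (fun F => I.filter fun i => 0 < ⟪z i, C F⟫_ℝ) ?_ ?_ ?_ ?_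
  · intro F hF F' hF' heq
    have hF := Finset.mem_coe.1 hF
    have hF' := Finset.mem_coe.1 hF'
    rw [← hC F hF, ← hC F' hF']
    refine hinj _ _ (hCL F hF) (hCL F' hF') fun i hi => ?_
    have := Finset.ext_iff.1 heq i
    simpa [hi] using this
  · intro F _
    exact Finset.mem_coe.2 (Finset.mem_powerset.2 (Finset.filter_subset _ _))
  · intro t ht hnot
    refine cham_zero α w I t hw0 ?_
    rintro ⟨x, hx⟩
    apply hnot
    set c := Lᗮ.starProjection x with hc
    have hin : ∀ i, ⟪w i, x⟫_ℝ = ⟪z i, c⟫_ℝ :=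
      fun i => Submodule.inner_starProjection_left_eq_right _ _ _
    simp only [hin] at hx
    have hcz : ∀ i, ⟪z i, c⟫_ℝ = 0 ↔ z i ∈ L := by
      intro i
      constructor
      · intro h
        by_contra hi
        have := hx i ((hI i).2 hi)
        by_cases hit : i ∈ t
        · exact (this.1 hit).ne' h
        · exact (this.2 hit).ne h
      · intro h
        exact Submodule.inner_right_of_mem_orthogonal h (Submodule.starProjection_apply_mem _ _)
    obtain ⟨F0, hF0, hF0n, hLF⟩ := hL
    obtain ⟨c0, rfl⟩ := exists_maxFace P F0 hF0 hF0n
    have hcL : vectorSpan ℝ (maxFace P c) = L := by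
      rw [hLF]
      refine flat_eq s z P hP hz c c0 (hne c) hF0n fun i => ?_
      rw [hcz, hzero c0 hLF.symm]
    have hFT : maxFace P c ∈ T := (hT _).2 ⟨maxFace_isFace P c, hne c, hcL⟩
    refine ⟨maxFace P c, hFT, ?_⟩
    have hsg := (hz _ _).2 (hC _ hFT)
    ext i
    simp only [Finset.mem_filter]
    have h1 := ((sign_eq_iff' _ _).1 (hsg i)).1
    rw [h1]
    constructor
    · rintro ⟨hi, hpos⟩
      by_contra hit
      exact absurd ((hx i hi).2 hit) hpos.le.not_gt
    · intro hit
      have hi := Finset.mem_powerset.1 ht hit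
      exact ⟨hi, (hx i hi).1 hit⟩
  · intro F hF
    rw [extAngle, ← outer_eq s z P hP hz (C F) (hne _) L (hCL F hF) I _ hI (by simp), hC F hF]

/-- Proposition: exterior angle vectors of belt polytopes.
For a `d`-dimensional belt polytope `P ⊂ ℝ^d`, any cone angle `α` and `0 ≤ i < d`:
`α̌_i(P) = W_i(L(P))`, the number of flats of `P` of dimension `i`. -/
theorem statement5 (d : ℕ) (hd : 0 < d) (α : ConeAngle d) (P : Set (Euc d))
    (hP : IsBeltPolytope P) (hdim : sdim P = d) (i : ℕ) (hi : i < d) :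
    extAngleSum α P i = (Nat.card {L : ↥(Flats P) // Module.finrank ℝ L.1 = i} : ℝ) := by
  classical
  obtain ⟨hPp, k, z, -, hz⟩ := hP
  set S : Set (Set (Euc d)) := {F | IsFace P F ∧ F.Nonempty ∧ sdim F = i} with hS
  have hfin : S.Finite := by
    have hC : ∀ F, ∃ c, F ∈ S → maxFace P c = F := by
      intro F
      by_cases h : F ∈ S
      · obtain ⟨c, hc⟩ := exists_maxFace P F h.1 h.2.1
        exact ⟨c, fun _ => hc⟩
      · exact ⟨0, fun h' => absurd h' h⟩
    choose C hC using hC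
    refine Set.Finite.of_finite_image (f := fun F =>
      ((Finset.univ.filter fun i => 0 < ⟪z i, C F⟫_ℝ, Finset.univ.filter fun i => ⟪z i, C F⟫_ℝ < 0) :
        Finset (Fin k) × Finset (Fin k))) (Set.toFinite _) ?_
    intro F hF F' hF' heq
    rw [← hC F hF, ← hC F' hF']
    refine (hz _ _).1 fun j => ?_
    simp only [Prod.mk.injEq] at heq
    have h1 := Finset.ext_iff.1 heq.1 j
    have h2 := Finset.ext_iff.1 heq.2 j
    simp only [Finset.mem_filter, Finset.mem_univ, true_and] at h1 h2
    exact (sign_eq_iff' _ _).2 ⟨h1, h2⟩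
  have hmem : ∀ F, F ∈ hfin.toFinset ↔ (IsFace P F ∧ F.Nonempty ∧ sdim F = i) := by
    intro F; rw [Set.Finite.mem_toFinset]; rfl
  rw [extAngleSum, finsum_mem_eq_finite_toFinset_sum _ hfin]
  rw [← Finset.sum_fiberwise_of_maps_to (s := hfin.toFinset) (g := fun F => vectorSpan ℝ F)
    (t := hfin.toFinset.image (fun F => vectorSpan ℝ F))
    (fun F hF => Finset.mem_image_of_mem _ hF)]
  have hone : ∀ L ∈ hfin.toFinset.image (fun F => vectorSpan ℝ F),
      ∑ F ∈ hfin.toFinset with vectorSpan ℝ F = L, extAngle α F P = 1 := by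
    intro L hL
    obtain ⟨F0, hF0, rfl⟩ := Finset.mem_image.1 hL
    rw [hmem] at hF0
    refine fiber_sum α P hPp z hz _ ⟨F0, hF0.1, hF0.2.1, rfl⟩ _ fun F => ?_
    rw [Finset.mem_filter, hmem]
    constructor
    · rintro ⟨h, h'⟩; exact ⟨h.1, h.2.1, h'⟩
    · rintro ⟨h, h1, h2⟩
      refine ⟨⟨h, h1, ?_⟩, h2⟩
      rw [← hF0.2.2, sdim, sdim, h2]
  rw [Finset.sum_congr rfl hone, Finset.sum_const, nsmul_eq_mul, mul_one,
    ← Nat.card_eq_finsetCard]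
  congr 1
  symm
  have hto : ∀ L : {L : ↥(Flats P) // Module.finrank ℝ L.1 = i},
      L.1.1 ∈ hfin.toFinset.image (fun F => vectorSpan ℝ F) := by
    rintro ⟨⟨L, F, hF, hFn, rfl⟩, hr⟩
    exact Finset.mem_image.2 ⟨F, (hmem F).2 ⟨hF, hFn, hr⟩, rfl⟩
  refine Nat.card_eq_of_bijective (fun L => ⟨L.1.1, hto L⟩) ⟨?_, ?_⟩
  · intro L L' h
    exact Subtype.ext (Subtype.ext (Subtype.mk.inj h))
  · rintro ⟨L, hL⟩
    obtain ⟨F, hF, rfl⟩ := Finset.mem_image.1 hL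
    rw [hmem] at hF
    exact ⟨⟨⟨_, F, hF.1, hF.2.1, rfl⟩, hF.2.2⟩, rfl⟩

end GramAngles
end
end
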